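/- arXiv:1312.2968 — 2 statements merged into one kernel-verified Lean document; each statement's English description precedes it below -/
import Mathlib

section
/- Let α > 0, τ, C, C' > 0 and β₀ > β₁ > 0 be given. Then there exist a sequence (ρ_n) of positive reals with limsup_{n→∞} ρ_n·n^{β₁/(2β₁+1)} < ∞ and tests (Ψ_n) that are α-uniformly consistent for testing H₀: F ∈ S(τ,β₀,C,C') against H₁: F ∈ S̃(τ,β₁,β₀,C,C',ρ_n). -/
open MeasureTheory Filter Set Asymptotics

noncomputable section

/-- The CDF of a measure on `ℝ`. -/
def cdfR (μ : Measure ℝ) (x : ℝ) : ℝ := (μ (Iic x)).toReal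

/-- The second order Pareto class `S(τ, β, C, C')`: càdlàg distribution functions on `[0,∞)`
(here encoded via their laws, probability measures giving no mass to `(-∞,0)`) such that
`|1 - F(x) - C·x^(-τ)| ≤ C'·x^(-τ(β+1))` whenever `F(x) ∈ (0,1]`. -/
def SOP (τ β C C' : ℝ) : Set (Measure ℝ) :=
  {μ | IsProbabilityMeasure μ ∧ μ (Iio 0) = 0 ∧
    ∀ x : ℝ, cdfR μ x ∈ Ioc (0 : ℝ) 1 →
      |1 - cdfR μ x - C * x ^ (-τ)| ≤ C' * x ^ (-(τ * (β + 1)))}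

/-- The distance `‖F - S‖_{∞,τ} = inf_{F₀ ∈ S} sup_{x : F(x) ∈ (0,1)} |x^τ(1-F(x)) - x^τ(1-F₀(x))|`. -/
def distToSet (τ : ℝ) (μ : Measure ℝ) (S : Set (Measure ℝ)) : ℝ :=
  ⨅ ν : S, ⨆ x : {x : ℝ | cdfR μ x ∈ Ioo (0 : ℝ) 1},
    |(x : ℝ) ^ τ * (1 - cdfR μ (x : ℝ)) - (x : ℝ) ^ τ * (1 - cdfR (ν : Measure ℝ) (x : ℝ))|

/-- The separated class `S̃(τ, β₁, β₀, C, C', ρ)`. -/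
def SOPsep (τ β₁ β₀ C C' ρ : ℝ) : Set (Measure ℝ) :=
  {μ | μ ∈ SOP τ β₁ C C' ∧ ρ ≤ distToSet τ μ (SOP τ β₀ C C')}

/-- Joint law of `n` i.i.d. observations with common law `μ`. -/
def iidP (μ : Measure ℝ) (n : ℕ) : Measure (Fin n → ℝ) := Measure.pi fun _ => μ

/-- A sequence of tests (given by their rejection regions `R n`) is `α`-uniformly consistent
for hypotheses `H₀ n`, `H₁ n` if, for all sufficiently large `n`,
`sup_{F ∈ H₀} E_F[Ψ_n] + sup_{F ∈ H₁} E_F[1 - Ψ_n] ≤ α`. -/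
def UnifConsistent (α : ℝ) (H₀ H₁ : ℕ → Set (Measure ℝ))
    (R : (n : ℕ) → Set (Fin n → ℝ)) : Prop :=
  (∀ n, MeasurableSet (R n)) ∧
  ∀ᶠ n : ℕ in atTop,
    (⨆ μ : H₀ n, (iidP (μ : Measure ℝ) n (R n)).toReal) +
      (⨆ μ : H₁ n, (1 - (iidP (μ : Measure ℝ) n (R n)).toReal)) ≤ α

lemma cdfR_eq_cdf (μ : Measure ℝ) [IsProbabilityMeasure μ] (x : ℝ) :
    cdfR μ x = ProbabilityTheory.cdf μ x := (ProbabilityTheory.cdf_eq_real μ x).symm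

lemma cdfR_nonneg (μ : Measure ℝ) (x : ℝ) : 0 ≤ cdfR μ x := ENNReal.toReal_nonneg

lemma cdfR_mono (μ : Measure ℝ) [IsProbabilityMeasure μ] : Monotone (cdfR μ) := fun x y h => by
  simpa [cdfR_eq_cdf] using ProbabilityTheory.monotone_cdf μ h

lemma cdfR_le_one (μ : Measure ℝ) [IsProbabilityMeasure μ] (x : ℝ) : cdfR μ x ≤ 1 := by
  simpa [cdfR_eq_cdf] using ProbabilityTheory.cdf_le_one μ x

lemma tendsto_cdfR_atTop (μ : Measure ℝ) [IsProbabilityMeasure μ] :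
    Tendsto (cdfR μ) atTop (nhds 1) := by
  simpa [funext (cdfR_eq_cdf μ)] using ProbabilityTheory.tendsto_cdf_atTop μ

lemma tendsto_cdfR_right (μ : Measure ℝ) [IsProbabilityMeasure μ] (x : ℝ) :
    Tendsto (cdfR μ) (nhdsWithin x (Ioi x)) (nhds (cdfR μ x)) := by
  have h := ((ProbabilityTheory.cdf μ).right_continuous x).mono_left
    (nhdsWithin_mono x Ioi_subset_Ici_self)
  simpa [funext (cdfR_eq_cdf μ)] using h

/-- Distribution functions in the second order Pareto class never reach `1`. -/
lemma cdfR_lt_one {τ β C C' : ℝ} (hτ : 0 < τ) (hβ : 0 < β) (hC : 0 < C) {μ : Measure ℝ}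
    (hμ : μ ∈ SOP τ β C C') (x : ℝ) : cdfR μ x < 1 := by
  obtain ⟨hp, -, h⟩ := hμ
  refine lt_of_le_of_ne (cdfR_le_one μ x) fun hx => ?_
  have hlim : Tendsto (fun y : ℝ => C' * y ^ (-(τ * β))) atTop (nhds 0) := by
    simpa using (tendsto_rpow_neg_atTop (mul_pos hτ hβ)).const_mul C'
  obtain ⟨y, hy, hyx, hy0⟩ := ((hlim.eventually_lt_const hC).and
    ((eventually_ge_atTop x).and (eventually_gt_atTop 0))).exists
  have hFy : cdfR μ y = 1 := le_antisymm (cdfR_le_one μ y) (hx ▸ cdfR_mono μ hyx)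
  have := h y ⟨by rw [hFy]; norm_num, hFy.le⟩
  have hpos : 0 < y ^ (-τ) := Real.rpow_pos_of_pos hy0 _
  rw [hFy, sub_self, zero_sub, abs_neg, abs_of_pos (mul_pos hC hpos),
    show -(τ * (β + 1)) = -(τ * β) + -τ by ring, Real.rpow_add hy0, ← mul_assoc] at this
  exact absurd (le_of_mul_le_mul_right this hpos) (not_le.2 hy)

lemma cdfR_eq_zero_of_nonpos {τ β C C' : ℝ} (hτ : 0 < τ) (hβ : 0 < β) (hC : 0 < C)
    {μ : Measure ℝ} (hμ : μ ∈ SOP τ β C C') {x : ℝ} (hx : x ≤ 0) : cdfR μ x = 0 := by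
  have hlt := cdfR_lt_one hτ hβ hC hμ 0
  obtain ⟨hp, -, h⟩ := hμ
  suffices h0 : cdfR μ 0 = 0 from
    le_antisymm (h0 ▸ cdfR_mono μ hx) (cdfR_nonneg μ x)
  by_contra h0
  have := h 0 ⟨lt_of_le_of_ne (cdfR_nonneg μ 0) (Ne.symm h0), hlt.le⟩
  rw [Real.zero_rpow (by linarith), Real.zero_rpow (by nlinarith [mul_pos hτ hβ])] at this
  have := (abs_nonpos_iff.1 (this.trans_eq (mul_zero _)))
  linarith

/-- The weighted tail is bounded uniformly over the class, on the support. -/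
lemma rpow_mul_tail_le {τ β C C' : ℝ} (hτ : 0 < τ) (hβ : 0 < β) (hC : 0 < C) (hC' : 0 < C')
    {μ : Measure ℝ} (hμ : μ ∈ SOP τ β C C') {x : ℝ} (hx : 0 < x) (hF : 0 < cdfR μ x) :
    x ^ τ * (1 - cdfR μ x) ≤ 1 + C + C' := by
  obtain ⟨hp, -, h⟩ := hμ
  have hxτ : 0 < x ^ τ := Real.rpow_pos_of_pos hx _
  rcases le_total x 1 with h1 | h1
  · have : x ^ τ ≤ 1 := Real.rpow_le_one hx.le h1 hτ.le
    nlinarith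
  · have := (abs_le.1 (h x ⟨hF, cdfR_le_one μ x⟩)).2
    have e1 : x ^ τ * x ^ (-τ) = 1 := by rw [← Real.rpow_add hx]; simp
    have e2 : x ^ τ * x ^ (-(τ * (β + 1))) ≤ 1 := by
      rw [← Real.rpow_add hx]
      exact Real.rpow_le_one_of_one_le_of_nonpos h1 (by nlinarith [mul_pos hτ hβ])
    nlinarith

lemma half_rpow_neg_le_tail {τ β C C' : ℝ} {μ : Measure ℝ} (hμ : μ ∈ SOP τ β C C') {x : ℝ}
    (hx : 0 < x) (hF : 0 < cdfR μ x) (hB : C' * x ^ (-(τ * β)) ≤ C / 2) :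
    C / 2 * x ^ (-τ) ≤ 1 - cdfR μ x := by
  obtain ⟨hp, -, h⟩ := hμ
  have := (abs_le.1 (h x ⟨hF, cdfR_le_one μ x⟩)).1
  have hpos : 0 < x ^ (-τ) := Real.rpow_pos_of_pos hx _
  rw [show -(τ * (β + 1)) = -(τ * β) + -τ by ring, Real.rpow_add hx, ← mul_assoc] at this
  nlinarith

/-- A distribution function that violates the class constraint by at most `δ`, wherever it is not
negligible, is within `δ` of an element of the class. -/
lemma exists_mem_SOP_near {τ β C C' δ : ℝ} (hτ : 0 < τ) (hβ : 0 < β) (hC : 0 < C) (hC' : 0 < C')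
    (hδ : 0 < δ) (μ : Measure ℝ) [IsProbabilityMeasure μ]
    (h : ∀ y x, 0 < y → y ≤ x → δ < y ^ τ * cdfR μ y →
      |1 - cdfR μ x - C * x ^ (-τ)| ≤ C' * x ^ (-(τ * (β + 1))) + δ * x ^ (-τ)) :
    ∃ ν ∈ SOP τ β C C', ∀ x, 0 < x → |x ^ τ * (cdfR μ x - cdfR ν x)| ≤ δ := by
  classical
  set F := cdfR μ with hF
  have hFm : Monotone F := cdfR_mono μ
  have hF1 : ∀ x, F x ≤ 1 := cdfR_le_one μ
  have hF0 : ∀ x, 0 ≤ F x := cdfR_nonneg μ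
  set b : ℝ := τ * (β + 1) with hb
  have hb0 : 0 < b := by positivity
  let l : ℝ → ℝ := fun x => 1 - C * x ^ (-τ) - C' * x ^ (-b)
  let u : ℝ → ℝ := fun x => 1 - C * x ^ (-τ) + C' * x ^ (-b)
  let k : ℝ → ℝ := fun x => max (l x) (min (F x) (u x))
  let P : ℝ → Prop := fun x => ∃ y, 0 < y ∧ y ≤ x ∧ δ < y ^ τ * F y
  have hPpos : ∀ {x : ℝ}, P x → 0 < x := fun ⟨y, h0, hy, _⟩ => h0.trans_le hy
  have hPm : ∀ {x x' : ℝ}, x ≤ x' → P x → P x' := fun hx ⟨y, h0, hy, h1⟩ => ⟨y, h0, hy.trans hx, h1⟩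
  let H : ℝ → ℝ := fun x => ⨅ y : Ici x, k y
  let G : ℝ → ℝ := fun x => if P x then max 0 (H x) else 0
  have hpow : ∀ {x : ℝ}, 0 < x → ∀ a : ℝ, 0 < x ^ a := fun hx a => Real.rpow_pos_of_pos hx a
  have hanti : ∀ {x y : ℝ}, 0 < x → x ≤ y → ∀ {a : ℝ}, 0 < a → y ^ (-a) ≤ x ^ (-a) :=
    fun {_ _} hx hy {a} ha => Real.rpow_le_rpow_of_nonpos hx hy (by linarith)
  have hlm : ∀ {x y : ℝ}, 0 < x → x ≤ y → l x ≤ l y := by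
    intro x y hx hy
    have h1 := hanti hx hy hτ
    have h2 := hanti hx hy hb0
    simp only [l]
    nlinarith
  have hlu : ∀ {x : ℝ}, 0 < x → l x ≤ u x := by
    intro x hx
    have := mul_pos hC' (hpow hx (-b))
    simp only [l, u]; linarith
  have hbdd : ∀ {x : ℝ}, 0 < x → BddBelow (range fun y : Ici x => k y) := by
    intro x hx
    refine ⟨l x, ?_⟩
    rintro _ ⟨⟨y, hy⟩, rfl⟩
    exact (hlm hx hy).trans (le_max_left _ _)
  have hHk : ∀ {x : ℝ}, 0 < x → H x ≤ k x := fun {x} hx => ciInf_le (hbdd hx) ⟨x, self_mem_Ici⟩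
  have hlH : ∀ {x : ℝ}, 0 < x → l x ≤ H x := fun {x} hx =>
    le_ciInf fun y => (hlm hx y.2).trans (le_max_left _ _)
  have hHm : ∀ {x y : ℝ}, 0 < x → x ≤ y → H x ≤ H y := fun {x y} hx hy =>
    le_ciInf fun z => ciInf_le (hbdd hx) ⟨z, hy.trans z.2⟩
  have hGm : Monotone G := by
    intro x y hxy
    simp only [G]
    by_cases hx : P x
    · rw [if_pos hx, if_pos (hPm hxy hx)]
      exact max_le_max le_rfl (hHm (hPpos hx) hxy)
    · rw [if_neg hx]; split_ifs <;> simp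
  have hl : ∀ {x : ℝ}, P x → l x ≤ F x + δ * x ^ (-τ) := by
    rintro x ⟨y, h0, hy, h1⟩
    have := (abs_le.1 (h y x h0 hy h1)).2
    simp only [l]; linarith
  have hu : ∀ {x : ℝ}, P x → F x - δ * x ^ (-τ) ≤ u x := by
    rintro x ⟨y, h0, hy, h1⟩
    have := (abs_le.1 (h y x h0 hy h1)).1
    simp only [u]; linarith
  have hG1 : ∀ {x : ℝ}, P x → l x ≤ G x := fun {x} hx => by
    simp only [G, if_pos hx]; exact (hlH (hPpos hx)).trans (le_max_right _ _)
  have hG2 : ∀ {x : ℝ}, P x → G x ≤ max 0 (u x) := fun {x} hx => by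
    simp only [G, if_pos hx]
    exact max_le_max le_rfl ((hHk (hPpos hx)).trans
      (max_le (hlu (hPpos hx)) (min_le_right _ _)))
  have hG3 : ∀ {x : ℝ}, P x → F x - δ * x ^ (-τ) ≤ G x := fun {x} hx => by
    simp only [G, if_pos hx]
    refine le_trans (le_ciInf fun y => ?_) (le_max_right _ _)
    have h1 := hu (hPm y.2 hx)
    have h2 := hanti (hPpos hx) y.2 hτ
    have h3 := hFm y.2
    refine le_trans (le_min ?_ ?_) (le_max_right _ _)
    · have := mul_pos hδ (hpow (hPpos hx) (-τ)); linarith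
    · nlinarith
  have hG4 : ∀ {x : ℝ}, P x → G x ≤ F x + δ * x ^ (-τ) := fun {x} hx => by
    have hp := mul_pos hδ (hpow (hPpos hx) (-τ))
    simp only [G, if_pos hx]
    refine max_le (by linarith [hF0 x]) ((hHk (hPpos hx)).trans (max_le (hl hx) ?_))
    exact (min_le_left _ _).trans (by linarith)
  have hG5 : ∀ x, G x ≤ 1 := fun x => by
    by_cases hx : P x
    · simp only [G, if_pos hx]
      refine max_le zero_le_one ((hHk (hPpos hx)).trans (max_le ?_ ((min_le_left _ _).trans (hF1 x))))
      have h1 := mul_pos hC (hpow (hPpos hx) (-τ))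
      have h2 := mul_pos hC' (hpow (hPpos hx) (-b))
      simp only [l]; linarith
    · simp only [G, if_neg hx]; exact zero_le_one
  -- the right-continuous modification
  set f : StieltjesFunction ℝ := hGm.stieltjesFunction with hf
  have hfG : ∀ x, Tendsto G (nhdsWithin x (Ioi x)) (nhds (f x)) := fun x => by
    rw [hf, hGm.stieltjesFunction_eq]; exact hGm.tendsto_rightLim x
  have hGf : ∀ x, G x ≤ f x := fun x => by
    rw [hf, hGm.stieltjesFunction_eq]; exact hGm.le_rightLim le_rfl
  have hf1 : ∀ x, f x ≤ 1 := fun x => le_of_tendsto' (hfG x) hG5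
  have hfz : ∀ {x x' : ℝ}, x < x' → ¬ P x' → f x = 0 := by
    intro x x' hx hP
    refine tendsto_nhds_unique (hfG x) (tendsto_const_nhds.congr' ?_)
    filter_upwards [Ioo_mem_nhdsGT hx] with z hz
    simp only [G]; rw [if_neg fun hz' => hP (hPm hz.2.le hz')]
  have hPsmall : ∃ x, 0 < x ∧ ¬ P x := by
    refine ⟨δ ^ τ⁻¹, hpow hδ _, ?_⟩
    rintro ⟨y, h0, hy, h1⟩
    have : y ^ τ ≤ δ := by
      calc y ^ τ ≤ (δ ^ τ⁻¹) ^ τ := Real.rpow_le_rpow h0.le hy hτ.le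
        _ = δ := Real.rpow_inv_rpow hδ.le hτ.ne'
    have h2 : y ^ τ * F y ≤ y ^ τ * 1 := mul_le_mul_of_nonneg_left (hF1 y) (hpow h0 τ).le
    linarith
  obtain ⟨x₀, hx₀, hPx₀⟩ := hPsmall
  have hfneg : ∀ x, x ≤ 0 → f x = 0 := fun x hx => hfz (hx.trans_lt hx₀) hPx₀
  have hPev : ∀ᶠ x in atTop, P x := by
    have : Tendsto (fun y : ℝ => y ^ τ * F y) atTop atTop :=
      (tendsto_rpow_atTop hτ).atTop_mul_pos one_pos (tendsto_cdfR_atTop μ)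
    obtain ⟨y, h1, h0⟩ := ((this.eventually_gt_atTop δ).and (eventually_gt_atTop 0)).exists
    filter_upwards [eventually_ge_atTop y] with x hx using ⟨y, h0, hx, h1⟩
  have hltop : Tendsto l atTop (nhds 1) := by
    have h1 := (tendsto_rpow_neg_atTop hτ).const_mul C
    have h2 := (tendsto_rpow_neg_atTop hb0).const_mul C'
    simpa [l] using ((tendsto_const_nhds (x := (1 : ℝ))).sub h1).sub h2
  have hftop : Tendsto f atTop (nhds 1) :=
    tendsto_of_tendsto_of_tendsto_of_le_of_le' hltop tendsto_const_nhds
      (hPev.mono fun x hx => (hG1 hx).trans (hGf x)) (Eventually.of_forall hf1)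
  have hfbot : Tendsto f atBot (nhds 0) := by
    refine tendsto_const_nhds.congr' ?_
    filter_upwards [eventually_le_atBot 0] with x hx using (hfneg x hx).symm
  have hprob : IsProbabilityMeasure f.measure := f.isProbabilityMeasure hfbot hftop
  have hcdf : ∀ x, cdfR f.measure x = f x := fun x => by
    rw [cdfR_eq_cdf, ProbabilityTheory.cdf_measure_stieltjesFunction f hfbot hftop]
  have hcont : ∀ {x : ℝ}, 0 < x → ∀ a : ℝ,
      Tendsto (fun z : ℝ => z ^ a) (nhdsWithin x (Ioi x)) (nhds (x ^ a)) := fun {x} hx a =>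
    ((Real.continuousAt_rpow_const x a (Or.inl hx.ne')).tendsto).mono_left nhdsWithin_le_nhds
  refine ⟨f.measure, ⟨hprob, ?_, ?_⟩, ?_⟩
  · refine measure_mono_null Iio_subset_Iic_self ?_
    rw [f.measure_Iic hfbot, hfneg 0 le_rfl]; simp
  · intro x hx
    rw [hcdf] at hx ⊢
    have hP : ∀ z, x < z → P z := fun z hz => by
      by_contra hn; exact hx.1.ne' (hfz hz hn)
    have hx0 : 0 < x := by
      by_contra hn; exact hx.1.ne' (hfneg x (not_lt.1 hn))
    have hPn : ∀ᶠ z in nhdsWithin x (Ioi x), P z :=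
      eventually_nhdsWithin_of_forall hP
    have hlt : Tendsto l (nhdsWithin x (Ioi x)) (nhds (l x)) :=
      (tendsto_const_nhds.sub ((hcont hx0 _).const_mul C)).sub ((hcont hx0 _).const_mul C')
    have hut : Tendsto u (nhdsWithin x (Ioi x)) (nhds (u x)) :=
      (tendsto_const_nhds.sub ((hcont hx0 _).const_mul C)).add ((hcont hx0 _).const_mul C')
    have h1 : l x ≤ f x := le_of_tendsto_of_tendsto hlt (hfG x) (hPn.mono fun z hz => hG1 hz)
    have h2 : f x ≤ max 0 (u x) := le_of_tendsto_of_tendsto (hfG x)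
      (tendsto_const_nhds.max hut) (hPn.mono fun z hz => hG2 hz)
    have h3 : f x ≤ u x := by
      rcases le_max_iff.1 h2 with h | h
      · exact absurd hx.1 (not_lt.2 h)
      · exact h
    simp only [l, u] at h1 h3
    rw [abs_le]; constructor <;> linarith
  · intro x hx
    rw [hcdf, abs_mul, abs_of_pos (hpow hx τ)]
    by_cases hP : ∀ z, x < z → P z
    · have hPn : ∀ᶠ z in nhdsWithin x (Ioi x), P z :=
        eventually_nhdsWithin_of_forall hP
      have hFt : Tendsto F (nhdsWithin x (Ioi x)) (nhds (F x)) := tendsto_cdfR_right μ x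
      have h1 : F x - δ * x ^ (-τ) ≤ f x := le_of_tendsto_of_tendsto
        (hFt.sub ((hcont hx _).const_mul δ)) (hfG x) (hPn.mono fun z hz => hG3 hz)
      have h2 : f x ≤ F x + δ * x ^ (-τ) := le_of_tendsto_of_tendsto
        (hfG x) (hFt.add ((hcont hx _).const_mul δ)) (hPn.mono fun z hz => hG4 hz)
      have h3 : |F x - f x| ≤ δ * x ^ (-τ) := by rw [abs_le]; constructor <;> linarith
      have e1 : x ^ τ * x ^ (-τ) = 1 := by rw [← Real.rpow_add hx]; simp
      calc x ^ τ * |F x - f x| ≤ x ^ τ * (δ * x ^ (-τ)) :=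
            mul_le_mul_of_nonneg_left h3 (hpow hx τ).le
        _ = δ := by rw [mul_left_comm, e1, mul_one]
    · push Not at hP
      obtain ⟨z, hz, hPz⟩ := hP
      rw [hfz hz hPz, sub_zero, abs_of_nonneg (hF0 x)]
      by_contra hn
      exact hPz ⟨x, hx, hz.le, not_le.1 hn⟩

/-- The normalized tail indicator at level `t`, centered; a martingale in `t`. -/
def tailDev (μ : Measure ℝ) (t x : ℝ) : ℝ :=
  (Ioi t).indicator (fun _ => (1 - cdfR μ t)⁻¹) x - 1

/-- The sum of the normalized centered tail indicators over a sample. -/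
def tailSum (μ : Measure ℝ) {n : ℕ} (t : ℝ) (X : Fin n → ℝ) : ℝ := ∑ i, tailDev μ t (X i)

lemma measurable_tailDev (μ : Measure ℝ) (t : ℝ) : Measurable (tailDev μ t) :=
  (measurable_const.indicator measurableSet_Ioi).sub_const 1

lemma measurable_tailSum (μ : Measure ℝ) {n : ℕ} (t : ℝ) :
    Measurable (tailSum μ t : (Fin n → ℝ) → ℝ) :=
  Finset.measurable_sum _ fun i _ => (measurable_tailDev μ t).comp (measurable_pi_apply i)

lemma abs_tailDev_le (μ : Measure ℝ) (t x : ℝ) :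
    |tailDev μ t x| ≤ |(1 - cdfR μ t)⁻¹| + 1 := by
  unfold tailDev
  by_cases h : x ∈ Ioi t
  · rw [indicator_of_mem h]; exact (abs_sub _ _).trans (by simp)
  · rw [indicator_of_notMem h]; simp

lemma abs_tailSum_le (μ : Measure ℝ) {n : ℕ} (t : ℝ) (X : Fin n → ℝ) :
    |tailSum μ t X| ≤ n * (|(1 - cdfR μ t)⁻¹| + 1) := by
  refine (Finset.abs_sum_le_sum_abs _ _).trans
    ((Finset.sum_le_sum fun i _ => abs_tailDev_le μ t (X i)).trans ?_)
  simp [mul_add]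

lemma real_Ioi_eq (μ : Measure ℝ) [IsProbabilityMeasure μ] (t : ℝ) :
    μ.real (Ioi t) = 1 - cdfR μ t := by
  rw [← compl_Iic, probReal_compl_eq_one_sub measurableSet_Iic]; rfl

lemma integrable_tailDev (μ : Measure ℝ) [IsProbabilityMeasure μ] (t : ℝ) :
    Integrable (tailDev μ t) μ :=
  Integrable.of_bound (measurable_tailDev μ t).aestronglyMeasurable _
    (Eventually.of_forall (abs_tailDev_le μ t))

lemma integral_tailDev (μ : Measure ℝ) [IsProbabilityMeasure μ] {t : ℝ} (ht : cdfR μ t < 1) :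
    ∫ x, tailDev μ t x ∂μ = 0 := by
  unfold tailDev
  rw [integral_sub ((integrable_const _).indicator measurableSet_Ioi) (integrable_const _),
    integral_indicator_const _ measurableSet_Ioi, real_Ioi_eq]
  simp [mul_inv_cancel₀ (sub_pos.2 ht).ne']

lemma integral_tailDev_sq (μ : Measure ℝ) [IsProbabilityMeasure μ] {t : ℝ} (ht : cdfR μ t < 1) :
    ∫ x, tailDev μ t x ^ 2 ∂μ = cdfR μ t / (1 - cdfR μ t) := by
  have hS : 1 - cdfR μ t ≠ 0 := (sub_pos.2 ht).ne'
  have : ∀ x, tailDev μ t x ^ 2 =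
      (Ioi t).indicator (fun _ => (1 - cdfR μ t)⁻¹ ^ 2 - 2 * (1 - cdfR μ t)⁻¹) x + 1 := fun x => by
    unfold tailDev
    by_cases h : x ∈ Ioi t
    · simp only [indicator_of_mem h]; ring
    · simp only [indicator_of_notMem h]; ring
  simp_rw [this]
  rw [integral_add ((integrable_const _).indicator measurableSet_Ioi) (integrable_const _),
    integral_indicator_const _ measurableSet_Ioi, real_Ioi_eq]
  simp only [integral_const, probReal_univ, smul_eq_mul, mul_one]
  field_simp
  ring

instance isProbabilityMeasure_iidP (μ : Measure ℝ) [IsProbabilityMeasure μ] (n : ℕ) :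
    IsProbabilityMeasure (iidP μ n) := by unfold iidP; infer_instance

lemma integrable_of_abs_le {μ : Measure ℝ} [IsProbabilityMeasure μ] {n : ℕ}
    {g : (Fin n → ℝ) → ℝ} (hg : Measurable g) {c : ℝ} (hc : ∀ X, |g X| ≤ c) :
    Integrable g (iidP μ n) :=
  Integrable.of_bound hg.aestronglyMeasurable _ (Eventually.of_forall hc)

lemma integral_tailSum_sq (μ : Measure ℝ) [IsProbabilityMeasure μ] {t : ℝ} (ht : cdfR μ t < 1)
    (n : ℕ) : ∫ X, tailSum μ t X ^ 2 ∂(iidP μ n) = n * (cdfR μ t / (1 - cdfR μ t)) := by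
  have hL : MemLp (tailDev μ t) 2 μ :=
    MemLp.of_bound (measurable_tailDev μ t).aestronglyMeasurable _
      (Eventually.of_forall (abs_tailDev_le μ t))
  have h := ProbabilityTheory.variance_sum_pi (μ := fun _ : Fin n => μ)
    (X := fun _ => tailDev μ t) (fun _ => hL)
  have hZ : (∑ i, fun ω : Fin n → ℝ => tailDev μ t (ω i)) = tailSum μ t := by
    ext X; simp [tailSum]
  have h0 : ∫ X, tailSum μ t X ∂(iidP μ n) = 0 := by
    unfold tailSum iidP
    rw [integral_finsetSum]
    · refine Finset.sum_eq_zero fun i _ => ?_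
      exact (integral_comp_eval (μ := fun _ : Fin n => μ) (i := i)
        (measurable_tailDev μ t).aestronglyMeasurable).trans (integral_tailDev μ ht)
    · intro i _
      exact integrable_of_abs_le (μ := μ) ((measurable_tailDev μ t).comp (measurable_pi_apply i))
        (fun X => abs_tailDev_le μ t (X i))
  change ProbabilityTheory.variance _ (iidP μ n) = _ at h
  rw [hZ, ProbabilityTheory.variance_of_integral_eq_zero
    (measurable_tailSum μ t).aemeasurable h0, ProbabilityTheory.variance_of_integral_eq_zero
    (measurable_tailDev μ t).aemeasurable (integral_tailDev μ ht), integral_tailDev_sq μ ht] at h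
  simpa [iidP] using h

/-- `g` does not depend on the exact values of the coordinates exceeding `s`. -/
def FactorsBelow (s : ℝ) {n : ℕ} (g : (Fin n → ℝ) → ℝ) : Prop :=
  ∀ X Y : Fin n → ℝ, (∀ i, X i = Y i ∨ (s < X i ∧ s < Y i)) → g X = g Y

lemma factorsBelow_tailSum (μ : Measure ℝ) {n : ℕ} {r s : ℝ} (h : r ≤ s) :
    FactorsBelow s (tailSum μ r : (Fin n → ℝ) → ℝ) := by
  intro X Y hXY
  refine Finset.sum_congr rfl fun i _ => ?_
  rcases hXY i with h1 | ⟨h1, h2⟩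
  · rw [h1]
  · unfold tailDev
    rw [indicator_of_mem (mem_Ioi.2 (h.trans_lt h1)), indicator_of_mem (mem_Ioi.2 (h.trans_lt h2))]

lemma integral_tailDev_sub_mul (μ : Measure ℝ) [IsProbabilityMeasure μ] {n : ℕ} {s t : ℝ}
    (hst : s ≤ t) (ht : cdfR μ t < 1) {g : (Fin n → ℝ) → ℝ} (hg : FactorsBelow s g) (i : Fin n) :
    ∫ X, (tailDev μ t (X i) - tailDev μ s (X i)) * g X ∂(iidP μ n) = 0 := by
  obtain _ | n := n
  · exact i.elim0
  have hs : cdfR μ s < 1 := (cdfR_mono μ hst).trans_lt ht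
  have hmp := (measurePreserving_piFinSuccAbove (fun _ : Fin (n + 1) => μ) i).symm
  unfold iidP
  rw [← hmp.integral_comp']
  have key : ∀ p : ℝ × (Fin n → ℝ),
      (tailDev μ t ((MeasurableEquiv.piFinSuccAbove (fun _ => ℝ) i).symm p i) -
        tailDev μ s ((MeasurableEquiv.piFinSuccAbove (fun _ => ℝ) i).symm p i)) *
        g ((MeasurableEquiv.piFinSuccAbove (fun _ => ℝ) i).symm p) =
      (tailDev μ t p.1 - tailDev μ s p.1) * g (i.insertNth (s + 1) p.2) := by
    rintro ⟨a, Y⟩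
    simp only [MeasurableEquiv.piFinSuccAbove_symm_apply, Fin.insertNthEquiv_apply,
      Fin.insertNth_apply_same]
    by_cases ha : s < a
    · congr 1
      apply hg
      refine (Fin.forall_iff_succAbove i).2 ⟨Or.inr ?_, fun j => Or.inl ?_⟩
      · simp [ha]
      · simp
    · have h1 : a ∉ Ioi s := ha
      have h2 : a ∉ Ioi t := fun h => ha (hst.trans_lt h)
      simp [tailDev, indicator_of_notMem h1, indicator_of_notMem h2]
  simp_rw [key]
  rw [integral_prod_mul (fun a => tailDev μ t a - tailDev μ s a)
    (fun Y : Fin n → ℝ => g (i.insertNth (s + 1) Y)),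
    integral_sub (integrable_tailDev μ t) (integrable_tailDev μ s), integral_tailDev μ ht,
    integral_tailDev μ hs]
  simp

lemma integral_tailSum_sub_mul (μ : Measure ℝ) [IsProbabilityMeasure μ] {n : ℕ} {s t : ℝ}
    (hst : s ≤ t) (ht : cdfR μ t < 1) {g : (Fin n → ℝ) → ℝ} (hg : FactorsBelow s g)
    (hm : Measurable g) {c : ℝ} (hc : ∀ X, |g X| ≤ c) :
    ∫ X, (tailSum μ t X - tailSum μ s X) * g X ∂(iidP μ n) = 0 := by
  have hsum : ∀ X : Fin n → ℝ, (tailSum μ t X - tailSum μ s X) * g X =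
      ∑ i, (tailDev μ t (X i) - tailDev μ s (X i)) * g X := fun X => by
    rw [tailSum, tailSum, ← Finset.sum_sub_distrib, Finset.sum_mul]
  simp_rw [hsum]
  rw [integral_finsetSum]
  · exact Finset.sum_eq_zero fun i _ => integral_tailDev_sub_mul μ hst ht hg i
  · intro i _
    refine integrable_of_abs_le (c := ((|(1 - cdfR μ t)⁻¹| + 1) + (|(1 - cdfR μ s)⁻¹| + 1)) * c)
      ((((measurable_tailDev μ t).comp (measurable_pi_apply i)).sub
        ((measurable_tailDev μ s).comp (measurable_pi_apply i))).mul hm) fun X => ?_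
    rw [abs_mul]
    exact mul_le_mul ((abs_sub _ _).trans
      (add_le_add (abs_tailDev_le μ t _) (abs_tailDev_le μ s _))) (hc X) (abs_nonneg _)
      (by positivity)

/-- Doob's maximal inequality for the normalized tail process, over finitely many levels. -/
lemma maximal_ineq_tailSum_finset (μ : Measure ℝ) [IsProbabilityMeasure μ] (n : ℕ) {B l : ℝ}
    (hB : cdfR μ B < 1) (hl : 0 < l) (T : Finset ℝ) (hT : ∀ t ∈ T, t ≤ B) :
    l ^ 2 * (iidP μ n).real {X | ∃ t ∈ T, l ≤ |tailSum μ t X|} ≤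
      n * (cdfR μ B / (1 - cdfR μ B)) := by
  classical
  rw [← integral_tailSum_sq μ hB n]
  let A : ℝ → Set (Fin n → ℝ) := fun t =>
    {X | l ≤ |tailSum μ t X| ∧ ∀ s ∈ T, s < t → |tailSum μ s X| < l}
  have hAm : ∀ t, MeasurableSet (A t) := fun t => by
    have : {X : Fin n → ℝ | ∀ s ∈ T, s < t → |tailSum μ s X| < l} =
        ⋂ s ∈ T, ⋂ _ : s < t, {X | |tailSum μ s X| < l} := by ext; simp
    refine (measurableSet_le measurable_const (measurable_tailSum μ t).abs).inter
      (this ▸ ?_ : MeasurableSet {X : Fin n → ℝ | ∀ s ∈ T, s < t → |tailSum μ s X| < l})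
    exact Finset.measurableSet_biInter _ fun s _ => MeasurableSet.iInter fun _ =>
      measurableSet_lt (measurable_tailSum μ s).abs measurable_const
  let I : ℝ → (Fin n → ℝ) → ℝ := fun t => (A t).indicator 1
  let g : ℝ → (Fin n → ℝ) → ℝ := fun t X => I t X * tailSum μ t X
  have hI01 : ∀ t X, I t X = 0 ∨ I t X = 1 := fun t X => by
    by_cases h : X ∈ A t
    · right; exact indicator_of_mem h _
    · left; exact indicator_of_notMem h _
  have hgm : ∀ t, Measurable (g t) := fun t =>
    (measurable_one.indicator (hAm t)).mul (measurable_tailSum μ t)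
  have hgc : ∀ t X, |g t X| ≤ n * (|(1 - cdfR μ t)⁻¹| + 1) := fun t X => by
    refine le_trans ?_ (abs_tailSum_le μ t X)
    simp only [g]
    rcases hI01 t X with h | h <;> simp [h]
  have hgf : ∀ t, FactorsBelow t (g t) := fun t X Y hXY => by
    have h1 : ∀ s ≤ t, tailSum μ s X = tailSum μ s Y := fun s hs =>
      factorsBelow_tailSum μ hs X Y hXY
    have h2 : X ∈ A t ↔ Y ∈ A t := by
      simp only [A, mem_ofPred_eq, h1 t le_rfl]
      refine and_congr_right fun _ => forall₂_congr fun s _ => ?_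
      exact ⟨fun h hs => h1 s hs.le ▸ h hs, fun h hs => (h1 s hs.le).symm ▸ h hs⟩
    simp only [g, I, indicator, h2, h1 t le_rfl, Pi.one_apply]
  have hsum1 : ∀ X, ∑ t ∈ T, I t X ≤ 1 := fun X => by
    by_cases hX : ∃ t ∈ T, X ∈ A t
    · obtain ⟨t, ht, hXt⟩ := hX
      rw [Finset.sum_eq_single_of_mem t ht]
      · rcases hI01 t X with h | h <;> simp [h]
      · intro s hs hne
        refine indicator_of_notMem (fun hXs => ?_) _
        rcases lt_or_gt_of_ne hne with h | h
        · exact absurd hXs.1 (not_le.2 (hXt.2 s hs h))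
        · exact absurd hXt.1 (not_le.2 (hXs.2 t ht h))
    · push Not at hX
      rw [Finset.sum_eq_zero fun t ht => indicator_of_notMem (hX t ht) _]
      exact zero_le_one
  set E : Set (Fin n → ℝ) := {X | ∃ t ∈ T, l ≤ |tailSum μ t X|} with hE
  have hEm : MeasurableSet E := by
    have : E = ⋃ t ∈ T, {X | l ≤ |tailSum μ t X|} := by ext; simp [hE]
    rw [this]
    exact Finset.measurableSet_biUnion _ fun t _ =>
      measurableSet_le measurable_const (measurable_tailSum μ t).abs
  have hEI : ∀ X, E.indicator (1 : (Fin n → ℝ) → ℝ) X ≤ ∑ t ∈ T, I t X := fun X => by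
    have hnn : ∀ t ∈ T, 0 ≤ I t X := fun t _ => by
      rcases hI01 t X with h | h <;> simp [h]
    by_cases hX : X ∈ E
    · obtain ⟨t, ht, hmin⟩ := (T.filter fun t => l ≤ |tailSum μ t X|).exists_minimal
        (by obtain ⟨t, h1, h2⟩ := hX; exact ⟨t, by simp [h1, h2]⟩)
      rw [Finset.mem_filter] at ht
      have hXt : X ∈ A t := ⟨ht.2, fun s hs hst => by
        by_contra hn
        exact absurd (hmin (Finset.mem_filter.2 ⟨hs, not_lt.1 hn⟩) hst.le) (not_le.2 hst)⟩
      have h1 : I t X = 1 := indicator_of_mem hXt _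
      have h2 := Finset.single_le_sum hnn ht.1
      rw [indicator_of_mem hX]
      exact h1.symm.le.trans h2
    · rw [indicator_of_notMem hX]
      exact Finset.sum_nonneg hnn
  have hpt : ∀ X, l ^ 2 * E.indicator (1 : (Fin n → ℝ) → ℝ) X +
      2 * ∑ t ∈ T, (tailSum μ B X - tailSum μ t X) * g t X ≤ tailSum μ B X ^ 2 := fun X => by
    have h1 : ∀ t ∈ T, l ^ 2 * I t X + 2 * ((tailSum μ B X - tailSum μ t X) * g t X) ≤
        I t X * tailSum μ B X ^ 2 := fun t _ => by
      by_cases h : X ∈ A t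
      · have h2 : I t X = 1 := indicator_of_mem h _
        have h3 : l ^ 2 ≤ tailSum μ t X ^ 2 := by
          rw [← sq_abs (tailSum μ t X)]; exact pow_le_pow_left₀ hl.le h.1 2
        simp only [g, h2]
        nlinarith [sq_nonneg (tailSum μ B X - tailSum μ t X)]
      · have h2 : I t X = 0 := indicator_of_notMem h _
        simp [g, h2]
    calc _ ≤ l ^ 2 * ∑ t ∈ T, I t X + 2 * ∑ t ∈ T, (tailSum μ B X - tailSum μ t X) * g t X := by
          gcongr; exact hEI X
      _ = ∑ t ∈ T, (l ^ 2 * I t X + 2 * ((tailSum μ B X - tailSum μ t X) * g t X)) := by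
          rw [Finset.sum_add_distrib, Finset.mul_sum, Finset.mul_sum]
      _ ≤ ∑ t ∈ T, I t X * tailSum μ B X ^ 2 := Finset.sum_le_sum h1
      _ = (∑ t ∈ T, I t X) * tailSum μ B X ^ 2 := by rw [Finset.sum_mul]
      _ ≤ 1 * tailSum μ B X ^ 2 := by gcongr; exact hsum1 X
      _ = _ := one_mul _
  have hint1 : Integrable (fun X => l ^ 2 * E.indicator (1 : (Fin n → ℝ) → ℝ) X) (iidP μ n) :=
    ((integrable_const (1 : ℝ)).indicator hEm).const_mul _
  have hint2 : ∀ t ∈ T, Integrable (fun X => (tailSum μ B X - tailSum μ t X) * g t X)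
      (iidP μ n) := fun t _ => by
    refine integrable_of_abs_le (c := (n * (|(1 - cdfR μ B)⁻¹| + 1) +
      n * (|(1 - cdfR μ t)⁻¹| + 1)) * (n * (|(1 - cdfR μ t)⁻¹| + 1)))
      (((measurable_tailSum μ B).sub (measurable_tailSum μ t)).mul (hgm t)) fun X => ?_
    rw [abs_mul]
    exact mul_le_mul ((abs_sub _ _).trans
      (add_le_add (abs_tailSum_le μ B X) (abs_tailSum_le μ t X))) (hgc t X) (abs_nonneg _)
      (by positivity)
  have hint2' := (integrable_finsetSum T hint2).const_mul 2
  have hint3 : Integrable (fun X => tailSum μ B X ^ 2) (iidP μ n) := by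
    refine integrable_of_abs_le (c := (n * (|(1 - cdfR μ B)⁻¹| + 1)) ^ 2)
      ((measurable_tailSum μ B).pow_const 2) fun X => ?_
    rw [abs_pow]
    exact pow_le_pow_left₀ (abs_nonneg _) (abs_tailSum_le μ B X) 2
  have := integral_mono (hint1.add hint2') hint3 hpt
  rw [integral_add' hint1 hint2', integral_const_mul, integral_indicator_one hEm,
    integral_const_mul, integral_finsetSum _ hint2,
    Finset.sum_eq_zero fun t ht => integral_tailSum_sub_mul μ (hT t ht) hB (hgf t) (hgm t) (hgc t)]
    at this
  simpa using this

/-- Doob's maximal inequality for the normalized tail process, over countably many levels. -/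
lemma maximal_ineq_tailSum (μ : Measure ℝ) [IsProbabilityMeasure μ] (n : ℕ) {B l : ℝ}
    (hB : cdfR μ B < 1) (hl : 0 < l) (q : ℕ → ℝ) (hq : ∀ k, q k ≤ B) :
    iidP μ n {X | ∃ k, l ≤ |tailSum μ (q k) X|} ≤
      ENNReal.ofReal (n * (cdfR μ B / (1 - cdfR μ B)) / l ^ 2) := by
  classical
  rw [ofPred_exists, measure_iUnion_eq_iSup_accumulate]
  refine iSup_le fun N => ?_
  have h := maximal_ineq_tailSum_finset μ n hB hl ((Finset.range (N + 1)).image q)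
    (by simp only [Finset.mem_image]; rintro _ ⟨k, -, rfl⟩; exact hq k)
  rw [mul_comm, ← le_div_iff₀ (by positivity)] at h
  refine le_trans (measure_mono ?_) ((ENNReal.le_ofReal_iff_toReal_le (measure_ne_top _ _)
    (measureReal_nonneg.trans h)).2 h)
  intro X hX
  obtain ⟨k, hk, hX⟩ := mem_accumulate.1 hX
  exact ⟨q k, Finset.mem_image_of_mem _ (Finset.mem_range.2 (by omega)), hX⟩

/-- The empirical distribution function of the sample `X`. -/
def empCdf {n : ℕ} (X : Fin n → ℝ) (x : ℝ) : ℝ := (∑ i, (Iic x).indicator 1 (X i)) / n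

lemma measurable_empCdf {n : ℕ} (x : ℝ) : Measurable fun X : Fin n → ℝ => empCdf X x :=
  (Finset.measurable_sum _ fun i _ =>
    (measurable_one.indicator measurableSet_Iic).comp (measurable_pi_apply i)).div_const _

lemma tailSum_eq (μ : Measure ℝ) {n : ℕ} (hn : 0 < n) {t : ℝ} (ht : cdfR μ t < 1)
    (X : Fin n → ℝ) :
    (1 - cdfR μ t) * tailSum μ t X = n * (cdfR μ t - empCdf X t) := by
  have hS : 1 - cdfR μ t ≠ 0 := (sub_pos.2 ht).ne'
  have hn' : (n : ℝ) ≠ 0 := by positivity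
  have h : ∀ i, (1 - cdfR μ t) * tailDev μ t (X i) =
      cdfR μ t - (Iic t).indicator 1 (X i) := fun i => by
    unfold tailDev
    by_cases hi : X i ≤ t
    · rw [indicator_of_notMem (by simpa using hi), indicator_of_mem (by simpa using hi)]
      simp
    · rw [indicator_of_mem (by simpa using hi), indicator_of_notMem (by simpa using hi)]
      field_simp
      ring
  rw [tailSum, Finset.mul_sum, Finset.sum_congr rfl fun i _ => h i, Finset.sum_sub_distrib, empCdf]
  field_simp
  simp

/-- The samples whose empirical distribution function deviates from that of `μ` by more than `ε`,
in the weighted norm, at some rational level in `(0, B]`. -/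
def badEvent (τ B ε : ℝ) (μ : Measure ℝ) (n : ℕ) : Set (Fin n → ℝ) :=
  {X | ∃ q : ℚ, 0 < (q : ℝ) ∧ (q : ℝ) ≤ B ∧ ε < (q : ℝ) ^ τ * |empCdf X q - cdfR μ q|}

lemma iidP_badEvent_le {τ β C C' B ε : ℝ} (hτ : 0 < τ) (hβ : 0 < β) (hC : 0 < C) (hC' : 0 < C')
    (hB : 0 < B) (hε : 0 < ε) (hBC : C' * B ^ (-(τ * β)) ≤ C / 2) {μ : Measure ℝ}
    (hμ : μ ∈ SOP τ β C C') {n : ℕ} (hn : 0 < n) :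
    iidP μ n (badEvent τ B ε μ n) ≤
      ENNReal.ofReal (2 * (1 + C + C') ^ 2 * B ^ τ / (C * n * ε ^ 2)) := by
  have hp : IsProbabilityMeasure μ := hμ.1
  have hlt := cdfR_lt_one hτ hβ hC hμ
  have hn' : (0 : ℝ) < n := by positivity
  set D := 1 + C + C' with hD
  have hD0 : 0 < D := by positivity
  obtain ⟨e, he⟩ := exists_surjective_nat ℚ
  set l : ℝ := n * ε / D with hl
  have hl0 : 0 < l := by positivity
  let N : Set (Fin n → ℝ) := ⋃ q : {q : ℚ // cdfR μ q = 0}, ⋃ i, {X | X i ≤ (q.1 : ℝ)}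
  have hN : iidP μ n N = 0 := by
    refine measure_iUnion_null fun q => measure_iUnion_null fun i => ?_
    have h1 := (measurePreserving_eval (fun _ : Fin n => μ) i).measure_preimage
      (measurableSet_Iic (a := (q.1 : ℝ))).nullMeasurableSet
    refine h1.trans ?_
    exact ((ENNReal.toReal_eq_zero_iff _).1 q.2).resolve_right (measure_ne_top _ _)
  have hsub : badEvent τ B ε μ n ⊆
      N ∪ {X | ∃ k, l ≤ |tailSum μ (min (e k : ℝ) B) X|} := by
    rintro X ⟨q, hq0, hqB, hq⟩
    rcases (cdfR_nonneg μ q).eq_or_lt with h0 | h0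
    · left
      by_contra hX
      simp only [N, mem_iUnion, not_exists] at hX
      have : empCdf X q = 0 := by
        unfold empCdf
        rw [Finset.sum_eq_zero fun i _ =>
          indicator_of_notMem (fun hi : X i ∈ Iic (q : ℝ) => hX ⟨q, h0.symm⟩ i hi) _, zero_div]
      rw [this, ← h0] at hq
      simp at hq
      linarith
    · right
      obtain ⟨k, rfl⟩ := he q
      refine ⟨k, ?_⟩
      rw [min_eq_left hqB]
      have h1 := congrArg abs (tailSum_eq μ hn (hlt (e k)) X)
      rw [abs_mul, abs_mul, abs_of_pos (sub_pos.2 (hlt _)), abs_of_pos hn', abs_sub_comm] at h1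
      have h2 := rpow_mul_tail_le hτ hβ hC hC' hμ hq0 h0
      rw [hl, div_le_iff₀ hD0]
      calc n * ε ≤ n * ((e k : ℝ) ^ τ * |empCdf X (e k) - cdfR μ (e k)|) := by gcongr
        _ = |tailSum μ (e k) X| * ((e k : ℝ) ^ τ * (1 - cdfR μ (e k))) := by
          linear_combination (-(e k : ℝ) ^ τ) * h1
        _ ≤ |tailSum μ (e k) X| * D := by gcongr
  refine (measure_mono hsub).trans ((measure_union_le _ _).trans ?_)
  rw [hN, zero_add]
  refine (maximal_ineq_tailSum μ n (hlt B) hl0 _ fun k => min_le_right _ _).trans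
    (ENNReal.ofReal_le_ofReal ?_)
  have hBτ : 0 < B ^ τ := Real.rpow_pos_of_pos hB _
  have hF : cdfR μ B / (1 - cdfR μ B) ≤ 2 * B ^ τ / C := by
    rcases (cdfR_nonneg μ B).eq_or_lt with h0 | h0
    · rw [← h0, zero_div]; positivity
    · have h1 := half_rpow_neg_le_tail hμ hB h0 hBC
      rw [Real.rpow_neg hB.le] at h1
      calc cdfR μ B / (1 - cdfR μ B) ≤ 1 / (C / 2 * (B ^ τ)⁻¹) := by
            gcongr; exact cdfR_le_one μ B
        _ = 2 * B ^ τ / C := by field_simp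
  calc n * (cdfR μ B / (1 - cdfR μ B)) / l ^ 2 ≤ n * (2 * B ^ τ / C) / l ^ 2 := by gcongr
    _ = 2 * D ^ 2 * B ^ τ / (C * n * ε ^ 2) := by rw [hl]; field_simp

/-- The rejection region: the empirical distribution function visibly violates the second order
Pareto constraint at some level where it is not negligible. -/
def rejectRegion (τ β C C' B ε : ℝ) (n : ℕ) : Set (Fin n → ℝ) :=
  {X | ∃ y x : ℚ, 0 < (y : ℝ) ∧ (y : ℝ) ≤ x ∧ (x : ℝ) ≤ B ∧ ε < (y : ℝ) ^ τ * empCdf X y ∧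
    C' * (x : ℝ) ^ (-(τ * (β + 1))) + ε * (x : ℝ) ^ (-τ) <
      |1 - empCdf X x - C * (x : ℝ) ^ (-τ)|}

lemma measurableSet_rejectRegion (τ β C C' B ε : ℝ) (n : ℕ) :
    MeasurableSet (rejectRegion τ β C C' B ε n) := by
  refine .congr (s := ⋃ y : ℚ, ⋃ x : ℚ, ⋃ _ : 0 < (y : ℝ) ∧ (y : ℝ) ≤ x ∧ (x : ℝ) ≤ B,
    {X | ε < (y : ℝ) ^ τ * empCdf X y} ∩ {X | C' * (x : ℝ) ^ (-(τ * (β + 1))) +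
      ε * (x : ℝ) ^ (-τ) < |1 - empCdf X x - C * (x : ℝ) ^ (-τ)|}) ?_ ?_
  · refine .iUnion fun y => .iUnion fun x => .iUnion fun _ => .inter ?_ ?_
    · exact measurableSet_lt measurable_const ((measurable_empCdf _).const_mul _)
    · exact measurableSet_lt measurable_const
        (((measurable_empCdf _).const_sub _).sub_const _).abs
  · ext X
    simp only [rejectRegion, mem_iUnion, mem_inter_iff, mem_ofPred_eq, exists_prop, and_assoc]

lemma abs_sub_le_of_rpow_mul_le {τ x ε d : ℝ} (hx : 0 < x) (h : x ^ τ * d ≤ ε) :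
    d ≤ ε * x ^ (-τ) := by
  rw [Real.rpow_neg hx.le, ← div_eq_mul_inv, le_div_iff₀ (Real.rpow_pos_of_pos hx _)]
  linarith

lemma rejectRegion_subset_badEvent {τ β C C' B ε : ℝ} {μ : Measure ℝ}
    (hμ : μ ∈ SOP τ β C C') (n : ℕ) :
    rejectRegion τ β C C' B ε n ⊆ badEvent τ B ε μ n := by
  rintro X ⟨y, x, hy, hyx, hxB, h1, h2⟩
  by_contra hX
  simp only [badEvent, mem_ofPred_eq, not_exists, not_and, not_lt] at hX
  obtain ⟨hp, -, h⟩ := hμ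
  have hx : (0 : ℝ) < x := hy.trans_le hyx
  have hFy : 0 < cdfR μ y := by
    have h3 := hX y hy (hyx.trans hxB)
    have hyτ : 0 < (y : ℝ) ^ τ := Real.rpow_pos_of_pos hy _
    have h4 : (y : ℝ) ^ τ * (empCdf X y - cdfR μ y) ≤ (y : ℝ) ^ τ * |empCdf X y - cdfR μ y| :=
      mul_le_mul_of_nonneg_left (le_abs_self _) hyτ.le
    exact pos_of_mul_pos_right (by nlinarith : 0 < (y : ℝ) ^ τ * cdfR μ y) hyτ.le
  have h5 := h x ⟨hFy.trans_le (cdfR_mono μ hyx), cdfR_le_one μ x⟩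
  have h6 := abs_sub_le_of_rpow_mul_le hx (hX x hx hxB)
  have h7 := abs_sub_le (1 - empCdf X x - C * (x : ℝ) ^ (-τ))
    (1 - cdfR μ x - C * (x : ℝ) ^ (-τ)) 0
  rw [sub_zero, sub_zero, show 1 - empCdf X x - C * (x : ℝ) ^ (-τ) -
    (1 - cdfR μ x - C * (x : ℝ) ^ (-τ)) = -(empCdf X x - cdfR μ x) by ring, abs_neg] at h7
  linarith

/-- A law compatible with a sample that is not rejected is close to the null class. -/
lemma distToSet_le_of_notMem {τ β₀ β₁ C C' B ε δ : ℝ} (hτ : 0 < τ) (hβ₀ : 0 < β₀) (hβ₁ : 0 < β₁)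
    (hC : 0 < C) (hC' : 0 < C') (hB : 0 < B) (hδ : 0 < δ) (hεδ : 2 * ε ≤ δ)
    (hBδ : C' * B ^ (-(τ * β₁)) ≤ δ) {μ : Measure ℝ} (hμ : μ ∈ SOP τ β₁ C C') {n : ℕ}
    {X : Fin n → ℝ} (hX : X ∉ badEvent τ B ε μ n) (hR : X ∉ rejectRegion τ β₀ C C' B ε n) :
    distToSet τ μ (SOP τ β₀ C C') ≤ δ := by
  have hp : IsProbabilityMeasure μ := hμ.1
  simp only [badEvent, rejectRegion, mem_ofPred_eq, not_exists, not_and, not_lt] at hX hR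
  obtain ⟨ν, hν, hd⟩ := exists_mem_SOP_near hτ hβ₀ hC hC' hδ μ (by
    intro y x hy hyx hFy
    have hx : 0 < x := hy.trans_le hyx
    rcases lt_or_ge x B with hxB | hxB
    · by_contra! hlt
      have hcont : ∀ {z : ℝ}, 0 < z → ∀ a : ℝ,
          Tendsto (fun w : ℝ => w ^ a) (nhdsWithin z (Ioi z)) (nhds (z ^ a)) := fun {z} hz a =>
        ((Real.continuousAt_rpow_const z a (Or.inl hz.ne')).tendsto).mono_left nhdsWithin_le_nhds
      have hx' : ∀ᶠ z in nhdsWithin x (Ioi x),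
          C' * z ^ (-(τ * (β₀ + 1))) + δ * z ^ (-τ) < |1 - cdfR μ z - C * z ^ (-τ)| :=
        (((hcont hx _).const_mul C').add ((hcont hx _).const_mul δ)).eventually_lt
          ((tendsto_const_nhds.sub (tendsto_cdfR_right μ x)).sub
            ((hcont hx _).const_mul C)).abs hlt
      have hy' : ∀ᶠ z in nhdsWithin y (Ioi y), δ < z ^ τ * cdfR μ z :=
        ((hcont hy _).mul (tendsto_cdfR_right μ y)).eventually_const_lt hFy
      obtain ⟨a, hxa, ha⟩ := mem_nhdsGT_iff_exists_Ioo_subset.1 hx'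
      obtain ⟨b, hyb, hb⟩ := mem_nhdsGT_iff_exists_Ioo_subset.1 hy'
      obtain ⟨z, hxz, hz⟩ := exists_rat_btwn (lt_min hxa hxB)
      obtain ⟨w, hyw, hw⟩ := exists_rat_btwn (lt_min hyb (hyx.trans_lt hxz))
      have hz1 := ha ⟨hxz, hz.trans_le (min_le_left _ _)⟩
      have hw1 := hb ⟨hyw, hw.trans_le (min_le_left _ _)⟩
      have hzB : (z : ℝ) ≤ B := hz.le.trans (min_le_right _ _)
      have hwz : (w : ℝ) ≤ z := hw.le.trans (min_le_right _ _)
      have hw0 : (0 : ℝ) < w := hy.trans hyw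
      have hz0 : (0 : ℝ) < z := hx.trans hxz
      simp only [mem_ofPred_eq] at hz1 hw1
      have h1 : ε < (w : ℝ) ^ τ * empCdf X w := by
        have h3 := hX w hw0 (hwz.trans hzB)
        have h4 : (w : ℝ) ^ τ * (cdfR μ w - empCdf X w) ≤ (w : ℝ) ^ τ * |empCdf X w - cdfR μ w| :=
          mul_le_mul_of_nonneg_left (abs_sub_comm (empCdf X w) _ ▸ le_abs_self _)
            (Real.rpow_pos_of_pos hw0 _).le
        nlinarith
      have h2 := hR w z hw0 hwz hzB h1
      have h6 := abs_sub_le_of_rpow_mul_le hz0 (hX z hz0 hzB)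
      have h7 := abs_sub_le (1 - cdfR μ z - C * (z : ℝ) ^ (-τ))
        (1 - empCdf X z - C * (z : ℝ) ^ (-τ)) 0
      rw [sub_zero, sub_zero, show 1 - cdfR μ z - C * (z : ℝ) ^ (-τ) -
        (1 - empCdf X z - C * (z : ℝ) ^ (-τ)) = empCdf X z - cdfR μ z by ring] at h7
      have h8 : 2 * ε * (z : ℝ) ^ (-τ) ≤ δ * (z : ℝ) ^ (-τ) :=
        mul_le_mul_of_nonneg_right hεδ (Real.rpow_pos_of_pos hz0 _).le
      linarith
    · have hFy0 : 0 < cdfR μ y :=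
        pos_of_mul_pos_right (hδ.trans hFy) (Real.rpow_pos_of_pos hy _).le
      refine (hμ.2.2 x ⟨hFy0.trans_le (cdfR_mono μ hyx), cdfR_le_one μ x⟩).trans ?_
      have h1 : x ^ (-(τ * β₁)) ≤ B ^ (-(τ * β₁)) :=
        Real.rpow_le_rpow_of_nonpos hB hxB (by nlinarith [mul_pos hτ hβ₁])
      have h2 : 0 < x ^ (-τ) := Real.rpow_pos_of_pos hx _
      have h3 : 0 < C' * x ^ (-(τ * (β₀ + 1))) := mul_pos hC' (Real.rpow_pos_of_pos hx _)
      rw [show -(τ * (β₁ + 1)) = -(τ * β₁) + -τ by ring, Real.rpow_add hx, ← mul_assoc]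
      have h4 : C' * x ^ (-(τ * β₁)) ≤ δ := (mul_le_mul_of_nonneg_left h1 hC'.le).trans hBδ
      nlinarith)
  refine (ciInf_le ⟨0, ?_⟩ (⟨ν, hν⟩ : SOP τ β₀ C C')).trans (Real.iSup_le (fun x => ?_) hδ.le)
  · rintro _ ⟨ν', rfl⟩
    exact Real.iSup_nonneg fun x => abs_nonneg _
  · have hx : 0 < (x : ℝ) := by
      by_contra hn
      exact x.2.1.ne' (cdfR_eq_zero_of_nonpos hτ hβ₁ hC hμ (not_lt.1 hn))
    rw [← mul_sub, sub_sub_sub_cancel_left, abs_mul, abs_sub_comm, ← abs_mul]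
    exact hd x hx

/-- Theorem 1.A: for some `ρ_n` with `limsup ρ_n·n^{β₁/(2β₁+1)} < ∞`, there is an
`α`-uniformly consistent test of `H₀ : F ∈ S(τ,β₀,C,C')` vs
`H₁ : F ∈ S̃(τ,β₁,β₀,C,C',ρ_n)`. -/
theorem two_point_test_upper_bound
    (α τ C C' β₀ β₁ : ℝ) (hα : 0 < α) (hτ : 0 < τ) (hC : 0 < C) (hC' : 0 < C')
    (hβ₁ : 0 < β₁) (hβ : β₁ < β₀) :
    ∃ (ρ : ℕ → ℝ) (R : (n : ℕ) → Set (Fin n → ℝ)),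
      (∀ n, 0 < ρ n) ∧
      (∃ K : ℝ, ∀ᶠ n : ℕ in atTop, ρ n * (n : ℝ) ^ (β₁ / (2 * β₁ + 1)) ≤ K) ∧
      UnifConsistent α (fun _ => SOP τ β₀ C C')
        (fun n => SOPsep τ β₁ β₀ C C' (ρ n)) R := by
  have hβ₀ : 0 < β₀ := hβ₁.trans hβ
  set p : ℝ := 1 / (2 * β₁ + 1) with hp
  have hp0 : 0 < p := by positivity
  set D : ℝ := 1 + C + C' with hD
  have hD0 : 0 < D := by positivity
  set K : ℝ := √(4 * D ^ 2 / (C * α)) with hK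
  have hK0 : 0 < K := Real.sqrt_pos.2 (by positivity)
  have hK2 : K ^ 2 = 4 * D ^ 2 / (C * α) := Real.sq_sqrt (by positivity)
  let B : ℕ → ℝ := fun n => (n : ℝ) ^ (p / τ)
  let r : ℕ → ℝ := fun n => (n : ℝ) ^ (-(p * β₁))
  let M : ℝ := 2 * (2 * K + C')
  have hM : 0 < M := by positivity
  have hBtop : Tendsto B atTop atTop :=
    (tendsto_rpow_atTop (by positivity)).comp tendsto_natCast_atTop_atTop
  have hBev : ∀ β : ℝ, 0 < β → ∀ᶠ n in atTop, C' * B n ^ (-(τ * β)) ≤ C / 2 := fun β hβ' => by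
    have : Tendsto (fun n => C' * B n ^ (-(τ * β))) atTop (nhds 0) := by
      simpa using ((tendsto_rpow_neg_atTop (mul_pos hτ hβ')).comp hBtop).const_mul C'
    filter_upwards [this.eventually_lt_const (half_pos hC)] with n hn using hn.le
  refine ⟨fun n => if n = 0 then 1 else M * r n,
    fun n => rejectRegion τ β₀ C C' (B n) (K * r n) n, fun n => ?_, ⟨M, ?_⟩,
    fun n => measurableSet_rejectRegion _ _ _ _ _ _ _, ?_⟩
  · simp only
    split_ifs with hn
    · exact one_pos
    · have : (0 : ℝ) < n := by positivity
      exact mul_pos hM (Real.rpow_pos_of_pos this _)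
  · filter_upwards [eventually_gt_atTop 0] with n hn
    have hn' : (0 : ℝ) < n := by positivity
    rw [if_neg hn.ne', mul_assoc, ← Real.rpow_add hn',
      show -(p * β₁) + β₁ / (2 * β₁ + 1) = 0 by rw [hp]; ring, Real.rpow_zero, mul_one]
  · filter_upwards [eventually_gt_atTop 0, hBev β₀ hβ₀, hBev β₁ hβ₁] with n hn hn0 hn1
    have hn' : (0 : ℝ) < n := by positivity
    have hr : 0 < r n := Real.rpow_pos_of_pos hn' _
    have hB : 0 < B n := Real.rpow_pos_of_pos hn' _
    have hBτ : B n ^ τ = n * r n ^ 2 := by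
      simp only [B, r]
      rw [← Real.rpow_mul hn'.le, ← Real.rpow_natCast, ← Real.rpow_mul hn'.le]
      nth_rewrite 2 [← Real.rpow_one (n : ℝ)]
      rw [← Real.rpow_add hn']
      congr 1
      rw [hp]
      field_simp
      push_cast
      ring
    have hBr : B n ^ (-(τ * β₁)) = r n := by
      simp only [B, r]
      rw [← Real.rpow_mul hn'.le]
      congr 1
      field_simp
    have hbound : 2 * D ^ 2 * B n ^ τ / (C * n * (K * r n) ^ 2) = α / 2 := by
      rw [hBτ, mul_pow, hK2]
      field_simp
      norm_num
    have hbad : ∀ β : ℝ, 0 < β → C' * B n ^ (-(τ * β)) ≤ C / 2 → ∀ μ ∈ SOP τ β C C',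
        (iidP μ n (badEvent τ (B n) (K * r n) μ n)).toReal ≤ α / 2 := fun β hβ' hBβ μ hμ =>
      ENNReal.toReal_le_of_le_ofReal (by positivity)
        ((iidP_badEvent_le hτ hβ' hC hC' hB (mul_pos hK0 hr) hBβ hμ hn).trans_eq (by rw [hbound]))
    rw [← add_halves α]
    refine add_le_add (Real.iSup_le (fun μ => ?_) (by positivity))
      (Real.iSup_le (fun μ => ?_) (by positivity))
    · have := μ.2.1
      refine le_trans ?_ (hbad β₀ hβ₀ hn0 μ μ.2)
      exact ENNReal.toReal_mono (measure_ne_top _ _)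
        (measure_mono (rejectRegion_subset_badEvent μ.2 n))
    · obtain ⟨μ, hμ, hdist⟩ := μ
      have := hμ.1
      rw [if_neg hn.ne'] at hdist
      refine le_trans ?_ (hbad β₁ hβ₁ hn1 μ hμ)
      refine (probReal_compl_eq_one_sub (μ := iidP μ n)
        (measurableSet_rejectRegion τ β₀ C C' (B n) (K * r n) n)).symm.le.trans ?_
      refine measureReal_mono fun X hX => ?_
      by_contra hXb
      have hle := distToSet_le_of_notMem (δ := (2 * K + C') * r n) hτ hβ₀ hβ₁ hC hC' hB
        (by positivity) (by nlinarith [mul_pos hC' hr]) (by rw [hBr]; nlinarith [mul_pos hK0 hr])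
        hμ hXb hX
      have hpos : 0 < (2 * K + C') * r n := by positivity
      have : M * r n = 2 * ((2 * K + C') * r n) := by simp only [M]; ring
      linarith

end
end

section
/- Let α > 0, β₀ > β₁ > 0, C' > 0, and let I₁, I₂ be closed intervals contained in (0,∞). Then there exist a sequence (ρ_n) with limsup_{n→∞} ρ_n·n^{β₁/(2β₁+1)}/log(n) < ∞ and tests (Ψ_n) that are α-uniformly consistent for testing H₀: F ∈ ∪_{τ∈I₁,C∈I₂} S(τ,β₀,C,C') against H₁: F ∈ ∪_{τ∈I₁,C∈I₂} S̃(τ,β₁,β₀,C,C',ρ_n). -/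
open MeasureTheory Filter Set Asymptotics

noncomputable section

/-- `I` is a closed interval contained in `(0, ∞)`. -/
def IsClosedIntervalPos (I : Set ℝ) : Prop :=
  (∃ a b : ℝ, I = Icc a b) ∧ I ⊆ Ioi 0

lemma cdfR_rightCts (μ : Measure ℝ) [IsProbabilityMeasure μ] (x : ℝ) :
    ContinuousWithinAt (cdfR μ) (Ici x) x := by
  have : cdfR μ = ProbabilityTheory.cdf μ := funext (cdfR_eq_cdf μ)
  rw [this]; exact (ProbabilityTheory.cdf μ).right_continuous x

lemma cdfR_stieltjes (f : StieltjesFunction ℝ) (h0 : ∀ x, 0 ≤ f x)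
    (hf : Tendsto f atBot (nhds 0)) (x : ℝ) : cdfR f.measure x = f x := by
  rw [cdfR, f.measure_Iic hf, sub_zero, ENNReal.toReal_ofReal (h0 x)]

section SOPFacts

variable {τ β C C' : ℝ} {μ : Measure ℝ}

/-- Multiplying the second order Pareto condition by `x ^ τ`. -/
lemma SOP.weighted_bound (h : μ ∈ SOP τ β C C') {x : ℝ} (hx : 0 < x) (hF : 0 < cdfR μ x) :
    |x ^ τ * (1 - cdfR μ x) - C| ≤ C' * x ^ (-(τ * β)) := by
  obtain ⟨hp, -, hb⟩ := h
  have h1 := hb x ⟨hF, cdfR_le_one μ x⟩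
  have hxt : 0 < x ^ τ := Real.rpow_pos_of_pos hx _
  have e1 : x ^ τ * x ^ (-τ) = 1 := by rw [← Real.rpow_add hx]; simp
  have e2 : x ^ τ * x ^ (-(τ * (β + 1))) = x ^ (-(τ * β)) := by
    rw [← Real.rpow_add hx]; congr 1; ring
  calc |x ^ τ * (1 - cdfR μ x) - C| = x ^ τ * |1 - cdfR μ x - C * x ^ (-τ)| := by
        rw [← abs_of_pos hxt, ← abs_mul, abs_of_pos hxt]; congr 1
        linear_combination C * e1
    _ ≤ x ^ τ * (C' * x ^ (-(τ * (β + 1)))) := by gcongr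
    _ = C' * x ^ (-(τ * β)) := by rw [← e2]; ring

lemma SOP.pos_of_cdfR_pos (h : μ ∈ SOP τ β C C') (hτ : 0 < τ) (hβ : 0 < β) (hC : 0 < C)
    (hC' : 0 < C') {x : ℝ} (hF : 0 < cdfR μ x) : 0 < x := by
  have h' := h
  obtain ⟨hp, h0, hb⟩ := h
  by_contra! hx
  have hF0 : 0 < cdfR μ 0 := hF.trans_le (cdfR_mono μ hx)
  have h1 := hb 0 ⟨hF0, cdfR_le_one μ 0⟩
  rw [Real.zero_rpow (by linarith), Real.zero_rpow (by nlinarith)] at h1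
  have h2 : cdfR μ 0 = 1 := by
    simp only [mul_zero, sub_zero] at h1
    have := abs_nonpos_iff.mp h1; linarith
  set y : ℝ := ((C' + 1) / C) ^ (1 / (τ * β)) with hy
  have hpos : 0 < (C' + 1) / C := by positivity
  have hy0 : 0 < y := Real.rpow_pos_of_pos hpos _
  have hFy : cdfR μ y = 1 :=
    le_antisymm (cdfR_le_one μ y) (h2 ▸ cdfR_mono μ hy0.le)
  have h3 := SOP.weighted_bound h' hy0 (by rw [hFy]; exact one_pos)
  have h4 : y ^ (τ * β) = (C' + 1) / C := by
    rw [hy, ← Real.rpow_mul hpos.le, one_div_mul_cancel (by positivity), Real.rpow_one]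
  rw [hFy, Real.rpow_neg hy0.le, h4] at h3
  simp only [sub_self, mul_zero, zero_sub, abs_neg, abs_of_pos hC, inv_div] at h3
  have : C' * (C / (C' + 1)) < C := by
    rw [mul_div_assoc', div_lt_iff₀ (by positivity)]; nlinarith
  linarith

end SOPFacts

lemma rpow_tangent {p v w : ℝ} (hp : 1 ≤ p) (hv : 0 < v) (hw : 0 ≤ w) :
    v ^ p + p * v ^ (p - 1) * (w - v) ≤ w ^ p := by
  have h := one_add_mul_self_le_rpow_one_add (s := w / v - 1)
    (by have : 0 ≤ w / v := by positivity
        linarith) hp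
  rw [add_sub_cancel, Real.div_rpow hw hv.le] at h
  have hvp : 0 < v ^ p := Real.rpow_pos_of_pos hv _
  rw [le_div_iff₀ hvp] at h
  rw [Real.rpow_sub_one hv.ne']
  calc v ^ p + p * (v ^ p / v) * (w - v) = (1 + p * (w / v - 1)) * v ^ p := by
        field_simp
    _ ≤ _ := h

/-- The decreasing envelope of the lower edge of the second order Pareto band, in the variable
`u = x ^ (-τ)`; `m` is the maximizer of the lower edge. -/
def lowEnv (C C' p m u : ℝ) : ℝ := C * min u m - C' * (min u m) ^ p

section LowEnv

variable {C C' p m : ℝ}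

lemma lower_tangent (hC' : 0 < C') (hp : 1 ≤ p) {v w : ℝ} (hv : 0 < v) (hw : 0 ≤ w) :
    C * w - C' * w ^ p ≤ C * v - C' * v ^ p + (C - C' * (p * v ^ (p - 1))) * (w - v) := by
  have := mul_le_mul_of_nonneg_left (rpow_tangent hp hv hw) hC'.le
  nlinarith

lemma lower_mono (hC' : 0 < C') (hp : 1 < p) (hm : C' * (p * m ^ (p - 1)) = C) {v w : ℝ}
    (hw : 0 ≤ w) (hwv : w ≤ v) (hvm : v ≤ m) :
    C * w - C' * w ^ p ≤ C * v - C' * v ^ p := by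
  rcases hw.eq_or_lt with rfl | hw0
  · rcases hwv.eq_or_lt with rfl | hv0
    · exact le_rfl
    have h := lower_tangent (C := C) hC' hp.le hv0 le_rfl
    have h2 : v ^ (p - 1) ≤ m ^ (p - 1) := Real.rpow_le_rpow hv0.le hvm (by linarith)
    have h3 : C' * (p * v ^ (p - 1)) ≤ C := by rw [← hm]; gcongr
    nlinarith
  have hv0 := hw0.trans_le hwv
  have h := lower_tangent (C := C) hC' hp.le hv0 hw
  have h2 : v ^ (p - 1) ≤ m ^ (p - 1) := Real.rpow_le_rpow hv0.le hvm (by linarith)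
  have h3 : C' * (p * v ^ (p - 1)) ≤ C := by rw [← hm]; gcongr
  nlinarith

lemma lowEnv_mono (hC' : 0 < C') (hp : 1 < p) (hm0 : 0 < m) (hm : C' * (p * m ^ (p - 1)) = C)
    {v w : ℝ} (hw : 0 ≤ w) (hwv : w ≤ v) : lowEnv C C' p m w ≤ lowEnv C C' p m v :=
  lower_mono hC' hp hm (le_min hw hm0.le) (min_le_min_right m hwv) (min_le_right _ _)

lemma lower_le_lowEnv (hC' : 0 < C') (hp : 1 < p) (hm0 : 0 < m)
    (hm : C' * (p * m ^ (p - 1)) = C) {u : ℝ} (hu : 0 ≤ u) :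
    C * u - C' * u ^ p ≤ lowEnv C C' p m u := by
  unfold lowEnv
  rcases le_total u m with h | h
  · rw [min_eq_left h]
  · rw [min_eq_right h]
    have := lower_tangent (C := C) hC' hp.le hm0 hu
    rw [hm] at this; linarith

lemma lowEnv_le (hC : 0 < C) (hC' : 0 < C') (hm0 : 0 < m) {u : ℝ} (hu : 0 ≤ u) :
    lowEnv C C' p m u ≤ C * u := by
  unfold lowEnv
  have : 0 ≤ (min u m) ^ p := Real.rpow_nonneg (le_min hu hm0.le) _
  have h2 : C * min u m ≤ C * u := by gcongr; exact min_le_left _ _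
  nlinarith [mul_nonneg hC'.le this]

lemma continuous_lowEnv (hp : 0 < p) : Continuous (lowEnv C C' p m) := by
  unfold lowEnv
  have : Continuous fun u : ℝ => min u m := continuous_id.min continuous_const
  exact (continuous_const.mul this).sub
    (continuous_const.mul (this.rpow_const fun _ => Or.inr hp.le))

end LowEnv

/-- Projection of a distribution function onto the second order Pareto band at `x`, in terms of
`u = x ^ (-τ)` and of the value `y` of the distribution function. -/
def clipBand (C C' p m u y : ℝ) : ℝ :=
  max 0 (min (1 - lowEnv C C' p m u) (max (1 - (C * u + C' * u ^ p)) y))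

lemma continuous_clipBand {C C' p m : ℝ} (hp : 0 < p) :
    Continuous fun z : ℝ × ℝ => clipBand C C' p m z.1 z.2 := by
  unfold clipBand
  have h1 : Continuous fun z : ℝ × ℝ => z.1 ^ p :=
    continuous_fst.rpow_const fun _ => Or.inr hp.le
  have h2 : Continuous fun z : ℝ × ℝ => lowEnv C C' p m z.1 :=
    (continuous_lowEnv hp).comp continuous_fst
  fun_prop

lemma clipBand_mono {C C' p m : ℝ} (hC : 0 < C) (hC' : 0 < C') (hp : 1 < p) (hm0 : 0 < m)
    (hm : C' * (p * m ^ (p - 1)) = C) {u v y z : ℝ} (hv : 0 ≤ v) (hvu : v ≤ u) (hyz : y ≤ z) :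
    clipBand C C' p m u y ≤ clipBand C C' p m v z := by
  unfold clipBand
  have h1 := lowEnv_mono hC' hp hm0 hm hv hvu
  have h2 : v ^ p ≤ u ^ p := Real.rpow_le_rpow hv hvu (by linarith)
  have h3 : 1 - (C * u + C' * u ^ p) ≤ 1 - (C * v + C' * v ^ p) := by
    have : C * v + C' * v ^ p ≤ C * u + C' * u ^ p := by gcongr
    linarith
  exact max_le_max le_rfl (min_le_min (by linarith) (max_le_max h3 hyz))

/-- The projection of a distribution function `F` on the second order Pareto band, truncated where
`F < θ`. -/
def clipCdf (τ C C' p m θ : ℝ) (F : ℝ → ℝ) (x : ℝ) : ℝ :=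
  if θ ≤ F x then clipBand C C' p m (x ^ (-τ)) (F x) else 0

section ClipCdf

variable {τ C C' p m θ : ℝ} {F : ℝ → ℝ}

lemma clipBand_nonneg {u y : ℝ} : 0 ≤ clipBand C C' p m u y := le_max_left _ _

lemma clipCdf_nonneg (x : ℝ) : 0 ≤ clipCdf τ C C' p m θ F x := by
  unfold clipCdf; split_ifs
  · exact clipBand_nonneg
  · exact le_rfl

lemma clipCdf_mono (hτ : 0 < τ) (hC : 0 < C) (hC' : 0 < C') (hp : 1 < p) (hm0 : 0 < m)
    (hm : C' * (p * m ^ (p - 1)) = C) (hF : Monotone F) (hpos : ∀ x, θ ≤ F x → 0 < x) :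
    Monotone (clipCdf τ C C' p m θ F) := by
  intro x y hxy
  by_cases hx : θ ≤ F x
  · have hy := hx.trans (hF hxy)
    rw [clipCdf, clipCdf, if_pos hx, if_pos hy]
    exact clipBand_mono hC hC' hp hm0 hm (Real.rpow_pos_of_pos (hpos y hy) _).le
      (Real.rpow_le_rpow_of_nonpos (hpos x hx) hxy (by linarith)) (hF hxy)
  · rw [clipCdf, if_neg hx]; exact clipCdf_nonneg y

lemma clipCdf_rightCts (hp : 0 < p) (hF : Monotone F) (hpos : ∀ x, θ ≤ F x → 0 < x) {x : ℝ}
    (hFr : ContinuousWithinAt F (Ici x) x) :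
    ContinuousWithinAt (clipCdf τ C C' p m θ F) (Ici x) x := by
  by_cases hx : θ ≤ F x
  · have h1 : ContinuousWithinAt (fun y : ℝ => (y ^ (-τ), F y)) (Ici x) x :=
      ContinuousWithinAt.prodMk
        (Real.continuousAt_rpow_const x (-τ) (Or.inl (hpos x hx).ne')).continuousWithinAt hFr
    have hc : ContinuousWithinAt (fun y => clipBand C C' p m (y ^ (-τ)) (F y)) (Ici x) x :=
      ContinuousAt.comp_continuousWithinAt
        (f := fun y : ℝ => (y ^ (-τ), F y)) (continuous_clipBand hp).continuousAt h1
    refine hc.congr (fun y hy => ?_) ?_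
    · exact if_pos (hx.trans (hF hy))
    · exact if_pos hx
  · have : ∀ᶠ y in nhdsWithin x (Ici x), F y < θ :=
      hFr.eventually (Iio_mem_nhds (not_le.mp hx))
    refine (continuousWithinAt_const (b := (0 : ℝ))).congr_of_eventuallyEq ?_ ?_
    · filter_upwards [this] with y hy
      exact if_neg (not_le.mpr hy)
    · exact if_neg hx

lemma tendsto_clipCdf_atTop (hτ : 0 < τ) (hp : 0 < p) (hm0 : 0 < m) (hθ1 : θ < 1)
    (hF : Tendsto F atTop (nhds 1)) :
    Tendsto (clipCdf τ C C' p m θ F) atTop (nhds 1) := by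
  have h1 : Tendsto (fun x : ℝ => (x ^ (-τ), F x)) atTop (nhds ((0 : ℝ), (1 : ℝ))) :=
    (tendsto_rpow_neg_atTop hτ).prodMk_nhds hF
  have h2 := ((continuous_clipBand (C := C) (C' := C') (m := m) hp).tendsto
    ((0 : ℝ), (1 : ℝ))).comp h1
  have h3 : clipBand C C' p m 0 1 = 1 := by
    simp [clipBand, lowEnv, min_eq_left hm0.le, Real.zero_rpow hp.ne']
  rw [h3] at h2
  refine h2.congr' ?_
  filter_upwards [hF.eventually (Ioi_mem_nhds hθ1)] with x hx
  exact (if_pos (le_of_lt hx)).symm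

lemma exists_measure_clipCdf (hτ : 0 < τ) (hC : 0 < C) (hC' : 0 < C') (hp : 1 < p) (hm0 : 0 < m)
    (hm : C' * (p * m ^ (p - 1)) = C) (hθ1 : θ < 1) (hF : Monotone F)
    (hFr : ∀ x, ContinuousWithinAt F (Ici x) x) (hF1 : Tendsto F atTop (nhds 1))
    (hpos : ∀ x, θ ≤ F x → 0 < x) :
    ∃ ν : Measure ℝ, IsProbabilityMeasure ν ∧ ν (Iio 0) = 0 ∧
      ∀ x, cdfR ν x = clipCdf τ C C' p m θ F x := by
  have hzero : ∀ x ≤ 0, clipCdf τ C C' p m θ F x = 0 := fun x hx =>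
    if_neg fun h => absurd (hpos x h) (not_lt.mpr hx)
  have hbot : Tendsto (clipCdf τ C C' p m θ F) atBot (nhds 0) := by
    refine tendsto_const_nhds.congr' ?_
    filter_upwards [eventually_le_atBot (0 : ℝ)] with x hx
    exact (hzero x hx).symm
  let f : StieltjesFunction ℝ :=
    ⟨clipCdf τ C C' p m θ F, clipCdf_mono hτ hC hC' hp hm0 hm hF hpos,
      fun x => clipCdf_rightCts (by linarith) hF hpos (hFr x)⟩
  have hc : ∀ x, cdfR f.measure x = clipCdf τ C C' p m θ F x :=
    cdfR_stieltjes f clipCdf_nonneg hbot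
  have hprob : IsProbabilityMeasure f.measure :=
    f.isProbabilityMeasure hbot (tendsto_clipCdf_atTop hτ (by linarith) hm0 hθ1 hF1)
  refine ⟨f.measure, hprob, ?_, hc⟩
  have h0 : (f.measure (Iic 0)).toReal = 0 := (hc 0).trans (hzero 0 le_rfl)
  rw [ENNReal.toReal_eq_zero_iff] at h0
  exact measure_mono_null Iio_subset_Iic_self (h0.resolve_right (measure_ne_top _ _))

end ClipCdf

lemma clipBand_mem_band {C C' p m u y : ℝ} (hC : 0 < C) (hC' : 0 < C') (hp : 1 < p) (hm0 : 0 < m)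
    (hm : C' * (p * m ^ (p - 1)) = C) (hu : 0 ≤ u) (h : 0 < clipBand C C' p m u y) :
    |1 - clipBand C C' p m u y - C * u| ≤ C' * u ^ p := by
  have h1 := lower_le_lowEnv hC' hp hm0 hm hu
  have h2 := lowEnv_le (p := p) hC hC' hm0 hu
  have hup : 0 ≤ C' * u ^ p := mul_nonneg hC'.le (Real.rpow_nonneg hu _)
  unfold clipBand at h ⊢
  rw [max_eq_right (le_of_not_ge fun hle => by rw [max_eq_left hle] at h; exact lt_irrefl _ h)]
  have h3 := min_le_left (1 - lowEnv C C' p m u) (max (1 - (C * u + C' * u ^ p)) y)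
  have h4 : 1 - (C * u + C' * u ^ p) ≤
      min (1 - lowEnv C C' p m u) (max (1 - (C * u + C' * u ^ p)) y) :=
    le_min (by linarith) (le_max_left _ _)
  rw [abs_le]; constructor <;> linarith

lemma abs_sub_clipBand_le {C C' p m u y e : ℝ} (hy0 : 0 ≤ y) (he : 0 ≤ e)
    (hU : 1 - y ≤ C * u + C' * u ^ p + e) (hL : lowEnv C C' p m u - e ≤ 1 - y) :
    |y - clipBand C C' p m u y| ≤ e := by
  unfold clipBand
  have h1 : max 0 (min (1 - lowEnv C C' p m u) (max (1 - (C * u + C' * u ^ p)) y)) ≤ y + e :=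
    max_le (by linarith) ((min_le_right _ _).trans (max_le (by linarith) (by linarith)))
  have h2 : y - e ≤ max 0 (min (1 - lowEnv C C' p m u) (max (1 - (C * u + C' * u ^ p)) y)) :=
    le_max_of_le_right (le_min (by linarith) (le_max_of_le_right (by linarith)))
  rw [abs_le]; constructor <;> linarith

/-- If the band condition of `S(τ, β, C, C')` holds up to `r` wherever `F ≥ θ`, then `F` is within
`r` of the class. -/
lemma distToSet_le_of_band {τ β C C' r θ : ℝ} {μ : Measure ℝ} [IsProbabilityMeasure μ]
    (hτ : 0 < τ) (hβ : 0 < β) (hC : 0 < C) (hC' : 0 < C') (hr : 0 ≤ r) (hθ : 0 < θ)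
    (hθ1 : θ < 1)
    (hpos : ∀ x, 0 < cdfR μ x → 0 < x)
    (hsmall : ∀ x, 0 < cdfR μ x → cdfR μ x < θ → x ^ τ * cdfR μ x ≤ r)
    (hband : ∀ x, 0 < x → θ ≤ cdfR μ x →
      |x ^ τ * (1 - cdfR μ x) - C| ≤ C' * x ^ (-(τ * β)) + r) :
    distToSet τ μ (SOP τ β C C') ≤ r := by
  obtain ⟨p, hpdef⟩ : ∃ p, p = β + 1 := ⟨_, rfl⟩
  have hp : 1 < p := by linarith
  obtain ⟨m, hmdef⟩ : ∃ m, m = (C / (C' * p)) ^ (1 / β) := ⟨_, rfl⟩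
  have hbase : 0 < C / (C' * p) := by positivity
  have hm0 : 0 < m := hmdef ▸ Real.rpow_pos_of_pos hbase _
  have hm : C' * (p * m ^ (p - 1)) = C := by
    rw [hmdef, ← Real.rpow_mul hbase.le, show p - 1 = β by linarith,
      one_div_mul_cancel hβ.ne', Real.rpow_one]
    field_simp
  have hpw : ∀ x : ℝ, 0 < x → (x ^ (-τ)) ^ p = x ^ (-(τ * (β + 1))) := fun x hx => by
    rw [← Real.rpow_mul hx.le, hpdef]; congr 1; ring
  have hu0 : ∀ x : ℝ, 0 < x → 0 < x ^ (-τ) := fun x hx => Real.rpow_pos_of_pos hx _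
  have hxpos : ∀ x, θ ≤ cdfR μ x → 0 < x := fun x h => hpos x (hθ.trans_le h)
  -- the band condition in terms of `u = x ^ (-τ)`
  have hband' : ∀ x, 0 < x → θ ≤ cdfR μ x →
      |1 - cdfR μ x - C * x ^ (-τ)| ≤ C' * (x ^ (-τ)) ^ p + r * x ^ (-τ) := by
    intro x hx hθx
    have hxt : 0 < x ^ (-τ) := hu0 x hx
    have e1 : x ^ (-τ) * x ^ τ = 1 := by rw [← Real.rpow_add hx]; simp
    have e2 : x ^ (-τ) * x ^ (-(τ * β)) = (x ^ (-τ)) ^ p := by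
      rw [hpw x hx, ← Real.rpow_add hx]; congr 1; ring
    calc |1 - cdfR μ x - C * x ^ (-τ)|
        = x ^ (-τ) * |x ^ τ * (1 - cdfR μ x) - C| := by
          rw [← abs_of_pos hxt, ← abs_mul, abs_of_pos hxt]; congr 1
          linear_combination (-(1 - cdfR μ x)) * e1
      _ ≤ x ^ (-τ) * (C' * x ^ (-(τ * β)) + r) :=
          mul_le_mul_of_nonneg_left (hband x hx hθx) hxt.le
      _ = _ := by rw [← e2]; ring
  obtain ⟨ν, hν, hν0, hνc⟩ := exists_measure_clipCdf (τ := τ) hτ hC hC' hp hm0 hm hθ1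
    (cdfR_mono μ) (cdfR_rightCts μ) (tendsto_cdfR_atTop μ) hxpos
  have hmem : ν ∈ SOP τ β C C' := by
    refine ⟨hν, hν0, fun x hx => ?_⟩
    rw [hνc] at hx ⊢
    unfold clipCdf at hx ⊢
    by_cases hθx : θ ≤ cdfR μ x
    · rw [if_pos hθx] at hx ⊢
      have hx0 := hxpos x hθx
      rw [← hpw x hx0]
      exact clipBand_mem_band hC hC' hp hm0 hm (hu0 x hx0).le hx.1
    · rw [if_neg hθx] at hx; exact absurd hx.1 (lt_irrefl _)
  refine (ciInf_le ⟨0, ?_⟩ (⟨ν, hmem⟩ : SOP τ β C C')).trans ?_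
  · rintro _ ⟨κ, rfl⟩
    exact Real.iSup_nonneg fun x => abs_nonneg _
  refine Real.iSup_le (fun ⟨x, hx⟩ => ?_) hr
  have hx0 : 0 < x := hpos x hx.1
  have hxt : 0 < x ^ τ := Real.rpow_pos_of_pos hx0 _
  have hred : |x ^ τ * (1 - cdfR μ x) - x ^ τ * (1 - cdfR ν x)| =
      x ^ τ * |cdfR μ x - cdfR ν x| := by
    rw [← mul_sub, abs_mul, abs_of_pos hxt, abs_sub_comm]; congr 2; ring
  show |x ^ τ * (1 - cdfR μ x) - x ^ τ * (1 - cdfR ν x)| ≤ r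
  rw [hred, hνc]
  unfold clipCdf
  by_cases hθx : θ ≤ cdfR μ x
  · rw [if_pos hθx]
    have e1 : x ^ τ * (r * x ^ (-τ)) = r := by
      rw [mul_left_comm, ← Real.rpow_add hx0]; simp
    refine (mul_le_mul_of_nonneg_left ?_ hxt.le).trans e1.le
    have hb := abs_le.mp (hband' x hx0 hθx)
    refine abs_sub_clipBand_le (cdfR_nonneg μ x) (mul_nonneg hr (hu0 x hx0).le)
      (by linarith) ?_
    rcases le_total (x ^ (-τ)) m with hum | hum
    · rw [lowEnv, min_eq_left hum]; linarith
    · obtain ⟨y, hy⟩ : ∃ y, y = m ^ (-(1 / τ)) := ⟨_, rfl⟩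
      have hy0 : 0 < y := hy ▸ Real.rpow_pos_of_pos hm0 _
      have hyt : y ^ (-τ) = m := by
        rw [hy, ← Real.rpow_mul hm0.le, neg_mul_neg, one_div_mul_cancel hτ.ne', Real.rpow_one]
      have hxy : x ≤ y := by
        by_contra! hlt
        have := Real.rpow_lt_rpow_of_neg hy0 hlt (show -τ < 0 by linarith)
        linarith
      have hm1 := cdfR_mono μ hxy
      have hb2 := abs_le.mp (hband' y hy0 (hθx.trans hm1))
      rw [hyt] at hb2
      rw [lowEnv, min_eq_right hum]
      have : r * m ≤ r * x ^ (-τ) := mul_le_mul_of_nonneg_left hum hr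
      linarith
  · rw [if_neg hθx, sub_zero, abs_of_nonneg (cdfR_nonneg μ x)]
    exact hsmall x hx.1 (not_le.mp hθx)

/-- The fraction of the observations `ω` lying in `E`. -/
def empFrac {n : ℕ} (E : Set ℝ) (ω : Fin n → ℝ) : ℝ :=
  (∑ i, E.indicator (fun _ => (1 : ℝ)) (ω i)) / n

lemma empFrac_mono {n : ℕ} {E E' : Set ℝ} (h : E ⊆ E') (ω : Fin n → ℝ) :
    empFrac E ω ≤ empFrac E' ω := by
  unfold empFrac
  gcongr

lemma empFrac_nonneg {n : ℕ} (E : Set ℝ) (ω : Fin n → ℝ) : 0 ≤ empFrac E ω :=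
  div_nonneg (Finset.sum_nonneg fun _ _ => indicator_nonneg (fun _ _ => zero_le_one) _)
    (Nat.cast_nonneg n)

lemma empFrac_le_one {n : ℕ} (E : Set ℝ) (ω : Fin n → ℝ) : empFrac E ω ≤ 1 := by
  unfold empFrac
  refine div_le_one_of_le₀ ?_ (Nat.cast_nonneg n)
  calc ∑ i, E.indicator (fun _ => (1 : ℝ)) (ω i) ≤ ∑ _i : Fin n, (1 : ℝ) := by
        gcongr
        exact indicator_le_self' (fun _ _ => zero_le_one) _
    _ = n := by simp

instance iidP_isProbabilityMeasure (μ : Measure ℝ) [IsProbabilityMeasure μ] (n : ℕ) :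
    IsProbabilityMeasure (iidP μ n) := by unfold iidP; infer_instance

lemma exp_moment_indicator (μ : Measure ℝ) [IsProbabilityMeasure μ] {E : Set ℝ}
    (hE : MeasurableSet E) (s : ℝ) :
    ∫ x, Real.exp (s * E.indicator (fun _ => (1 : ℝ)) x) ∂μ
      = 1 + μ.real E * (Real.exp s - 1) := by
  have h : ∀ x, Real.exp (s * E.indicator (fun _ => (1 : ℝ)) x)
      = 1 + E.indicator (fun _ => Real.exp s - 1) x := fun x => by
    by_cases hx : x ∈ E <;> simp [hx]
  simp_rw [h]
  rw [integral_add (integrable_const _) ((integrable_const _).indicator hE),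
    integral_indicator_const _ hE]
  simp

lemma chernoff_one_sided (μ : Measure ℝ) [IsProbabilityMeasure μ] (n : ℕ) {E : Set ℝ}
    (hE : MeasurableSet E) (s c : ℝ) :
    (iidP μ n).real {ω | c ≤ s * ∑ i, E.indicator (fun _ => (1 : ℝ)) (ω i)}
      ≤ Real.exp (n * (μ.real E * (Real.exp s - 1)) - c) := by
  have hprod : ∀ ω : Fin n → ℝ, Real.exp (s * ∑ i, E.indicator (fun _ => (1 : ℝ)) (ω i))
      = ∏ i, Real.exp (s * E.indicator (fun _ => (1 : ℝ)) (ω i)) := fun ω => by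
    rw [Finset.mul_sum, Real.exp_sum]
  have hmeas : Measurable fun x => Real.exp (s * E.indicator (fun _ => (1 : ℝ)) x) :=
    ((measurable_const.indicator hE).const_mul s).exp
  have hexp1 : Integrable (fun x => Real.exp (s * E.indicator (fun _ => (1 : ℝ)) x)) μ := by
    refine Integrable.of_bound hmeas.aestronglyMeasurable (Real.exp |s|) (ae_of_all _ fun x => ?_)
    rw [Real.norm_eq_abs, Real.abs_exp, Real.exp_le_exp]
    by_cases hx : x ∈ E
    · simpa [hx] using le_abs_self s
    · simp [hx]
  have hexpn : Integrable
      (fun ω : Fin n → ℝ => Real.exp (s * ∑ i, E.indicator (fun _ => (1 : ℝ)) (ω i)))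
      (iidP μ n) := by
    simp_rw [hprod]
    exact Integrable.fintype_prod fun _ => hexp1
  have hval : ∫ ω, Real.exp (s * ∑ i, E.indicator (fun _ => (1 : ℝ)) (ω i)) ∂(iidP μ n)
      = (1 + μ.real E * (Real.exp s - 1)) ^ n := by
    simp_rw [hprod]
    rw [iidP, integral_fintype_prod_eq_prod
      (fun _ x => Real.exp (s * E.indicator (fun _ => (1 : ℝ)) x))]
    simp [exp_moment_indicator μ hE]
  have hmk := mul_meas_ge_le_integral_of_nonneg (ae_of_all _ fun ω => (Real.exp_pos _).le) hexpn
    (Real.exp c)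
  simp_rw [Real.exp_le_exp] at hmk
  rw [hval] at hmk
  have hpow : (1 + μ.real E * (Real.exp s - 1)) ^ n
      ≤ Real.exp (n * (μ.real E * (Real.exp s - 1))) := by
    rw [Real.exp_nat_mul]
    refine pow_le_pow_left₀ ?_ ?_ n
    · rw [← exp_moment_indicator μ hE s]
      exact integral_nonneg fun x => (Real.exp_pos _).le
    · linarith [Real.add_one_le_exp (μ.real E * (Real.exp s - 1))]
  rw [Real.exp_sub, le_div_iff₀ (Real.exp_pos c), mul_comm]
  exact hmk.trans hpow

/-- Two-sided Chernoff bound for the empirical frequency of a set. -/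
lemma chernoff (μ : Measure ℝ) [IsProbabilityMeasure μ] {n : ℕ} (hn : 0 < n) {E : Set ℝ}
    (hE : MeasurableSet E) {t : ℝ} (ht : 0 < t) (ht1 : t ≤ 1) (L : ℝ) :
    (iidP μ n).real {ω | t * μ.real E + L / (n * t) < |empFrac E ω - μ.real E|}
      ≤ 2 * Real.exp (-L) := by
  have hn' : (0 : ℝ) < n := by exact_mod_cast hn
  set q := μ.real E with hq
  have hq0 : 0 ≤ q := measureReal_nonneg
  set c₁ : ℝ := t * (n * q) + n * t ^ 2 * q + L with hc1
  set c₂ : ℝ := -t * (n * q) + n * t ^ 2 * q + L with hc2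
  have hsub : {ω : Fin n → ℝ | t * q + L / (n * t) < |empFrac E ω - q|} ⊆
      {ω | c₁ ≤ t * ∑ i, E.indicator (fun _ => (1 : ℝ)) (ω i)} ∪
        {ω | c₂ ≤ -t * ∑ i, E.indicator (fun _ => (1 : ℝ)) (ω i)} := by
    intro ω hω
    simp only [mem_ofPred_eq, mem_union] at hω ⊢
    set S := ∑ i, E.indicator (fun _ => (1 : ℝ)) (ω i) with hS
    have hemp : n * t * empFrac E ω = t * S := by
      rw [empFrac, ← hS]; field_simp
    have hL : n * t * (L / (n * t)) = L := by field_simp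
    have hnt : 0 < n * t := by positivity
    rcases lt_abs.mp hω with h | h
    · left
      have := mul_lt_mul_of_pos_left h hnt
      rw [mul_add, mul_sub, hL, hemp] at this
      rw [hc1]; nlinarith
    · right
      have := mul_lt_mul_of_pos_left h hnt
      rw [mul_add, hL, mul_neg, mul_sub, hemp] at this
      rw [hc2]; nlinarith
  have hexp1 : Real.exp t - 1 ≤ t + t ^ 2 := by
    have := abs_le.mp (Real.abs_exp_sub_one_sub_id_le (x := t) (by rw [abs_of_pos ht]; exact ht1))
    linarith
  have hexp2 : Real.exp (-t) - 1 ≤ -t + t ^ 2 := by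
    have := abs_le.mp (Real.abs_exp_sub_one_sub_id_le (x := -t)
      (by rw [abs_neg, abs_of_pos ht]; exact ht1))
    rw [neg_sq] at this
    linarith
  have b1 := chernoff_one_sided μ n hE t c₁
  have b2 := chernoff_one_sided μ n hE (-t) c₂
  have e1 : n * (q * (Real.exp t - 1)) - c₁ ≤ -L := by
    have : n * (q * (Real.exp t - 1)) ≤ n * (q * (t + t ^ 2)) := by gcongr
    rw [hc1]; linarith
  have e2 : n * (q * (Real.exp (-t) - 1)) - c₂ ≤ -L := by
    have : n * (q * (Real.exp (-t) - 1)) ≤ n * (q * (-t + t ^ 2)) := by gcongr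
    rw [hc2]; linarith
  calc _ ≤ _ := measureReal_mono hsub
    _ ≤ _ := measureReal_union_le _ _
    _ ≤ Real.exp (-L) + Real.exp (-L) :=
        add_le_add (b1.trans (Real.exp_le_exp.mpr e1)) (b2.trans (Real.exp_le_exp.mpr e2))
    _ = _ := by ring

lemma measureReal_Ioi (μ : Measure ℝ) [IsProbabilityMeasure μ] (x : ℝ) :
    μ.real (Ioi x) = 1 - cdfR μ x := by
  rw [← compl_Iic, probReal_compl_eq_one_sub measurableSet_Iic]; rfl

lemma exists_quantile (μ : Measure ℝ) [IsProbabilityMeasure μ] {p : ℝ} (hp : 0 < p) (hp1 : p < 1) :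
    ∃ t, (∀ x, p ≤ cdfR μ x ↔ t ≤ x) ∧ μ.real (Iio t) ≤ p := by
  have hbot : Tendsto (cdfR μ) atBot (nhds 0) := by
    have : cdfR μ = ProbabilityTheory.cdf μ := funext (cdfR_eq_cdf μ)
    rw [this]; exact ProbabilityTheory.tendsto_cdf_atBot μ
  obtain ⟨x₁, hx₁⟩ := ((tendsto_cdfR_atTop μ).eventually (Ioi_mem_nhds hp1)).exists
  obtain ⟨x₀, hx₀⟩ := (hbot.eventually (Iio_mem_nhds hp)).exists
  set S := {x | p ≤ cdfR μ x} with hS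
  have hne : S.Nonempty := ⟨x₁, le_of_lt hx₁⟩
  have hbd : BddBelow S := ⟨x₀, fun x hx => by
    by_contra! h
    exact absurd (hx.trans (cdfR_mono μ h.le)) (not_le.mpr hx₀)⟩
  have hmem : p ≤ cdfR μ (sInf S) := by
    by_contra! h
    have hev : ∀ᶠ y in nhdsWithin (sInf S) (Ici (sInf S)), cdfR μ y < p :=
      (cdfR_rightCts μ _).eventually (Iio_mem_nhds h)
    have hev' : ∀ᶠ y in nhdsWithin (sInf S) (Ioi (sInf S)), cdfR μ y < p :=
      hev.filter_mono (nhdsWithin_mono _ Ioi_subset_Ici_self)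
    obtain ⟨y, hy, hy2⟩ := (hev'.and self_mem_nhdsWithin).exists
    obtain ⟨z, hz, hzy⟩ := (csInf_lt_iff hbd hne).mp (show sInf S < y from hy2)
    exact absurd ((show p ≤ _ from hz).trans (cdfR_mono μ hzy.le)) (not_le.mpr hy)
  refine ⟨sInf S, fun x => ⟨fun h => csInf_le hbd h, fun h => hmem.trans (cdfR_mono μ h)⟩, ?_⟩
  set t := sInf S
  obtain ⟨u, hu, hut, hlim⟩ := exists_seq_strictMono_tendsto t
  have hun : Iio t = ⋃ k, Iic (u k) := by
    ext x
    simp only [mem_Iio, mem_iUnion, mem_Iic]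
    constructor
    · intro hx
      obtain ⟨k, hk⟩ := (hlim.eventually (Ioi_mem_nhds hx)).exists
      exact ⟨k, le_of_lt hk⟩
    · rintro ⟨k, hk⟩; exact hk.trans_lt (hut k)
  have htend : Tendsto (fun k => μ (Iic (u k))) atTop (nhds (μ (Iio t))) := by
    rw [hun]
    exact tendsto_measure_iUnion_atTop fun i j hij => Iic_subset_Iic.mpr (hu.monotone hij)
  have htend' := (ENNReal.tendsto_toReal (measure_ne_top μ _)).comp htend
  refine le_of_tendsto htend' (Eventually.of_forall fun k => ?_)
  show cdfR μ (u k) ≤ p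
  by_contra! h
  exact absurd (csInf_le hbd (show u k ∈ S from h.le)) (not_le.mpr (hut k))

lemma exists_cell {n : ℕ} (hn : 0 < n) {y : ℝ} (hy0 : 0 ≤ y) (hy1 : y ≤ 1) :
    ∃ k < n, (k : ℝ) / n ≤ y ∧ y ≤ ((k + 1 : ℕ) : ℝ) / n ∧
      (k + 1 < n → y < ((k + 1 : ℕ) : ℝ) / n) := by
  have hn' : (0 : ℝ) < n := by exact_mod_cast hn
  rcases hy1.eq_or_lt with rfl | hlt
  · refine ⟨n - 1, by omega, ?_, ?_, fun h => by omega⟩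
    · rw [div_le_one hn']; exact_mod_cast Nat.sub_le n 1
    · rw [Nat.sub_add_cancel hn, div_self hn'.ne']
  · have hlt2 : y < ((⌊y * n⌋₊ + 1 : ℕ) : ℝ) / n := by
      rw [lt_div_iff₀ hn']; push_cast; exact Nat.lt_floor_add_one _
    refine ⟨⌊y * n⌋₊, ?_, ?_, hlt2.le, fun _ => hlt2⟩
    · rw [Nat.floor_lt (by positivity)]; nlinarith
    · rw [div_le_iff₀ hn']; exact Nat.floor_le (by positivity)

/-- Uniform concentration of the empirical survival function. -/
lemma uniform_chernoff (μ : Measure ℝ) [IsProbabilityMeasure μ] {n : ℕ} (hn : 0 < n)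
    {t : ℝ} (ht : 0 < t) (ht1 : t ≤ 1) {L : ℝ} (hL : 0 ≤ L) :
    (iidP μ n).real {ω | ∃ x, t * (1 - cdfR μ x) + (L + 2) / (n * t)
        < |empFrac (Ioi x) ω - (1 - cdfR μ x)|}
      ≤ n * (4 * Real.exp (-L)) := by
  have hn' : (0 : ℝ) < n := by exact_mod_cast hn
  have hq : ∀ k : ℕ, ∃ T : ℝ, 0 < k → k < n →
      (∀ x, (k : ℝ) / n ≤ cdfR μ x ↔ T ≤ x) ∧ μ.real (Iio T) ≤ (k : ℝ) / n := by
    intro k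
    by_cases hk : 0 < k ∧ k < n
    · obtain ⟨T, hT⟩ := exists_quantile μ (p := (k : ℝ) / n)
        (div_pos (by exact_mod_cast hk.1) hn') (by rw [div_lt_one hn']; exact_mod_cast hk.2)
      exact ⟨T, fun _ _ => hT⟩
    · exact ⟨0, fun h1 h2 => absurd ⟨h1, h2⟩ hk⟩
  choose T hT using hq
  set bad : Set ℝ → Set (Fin n → ℝ) := fun E =>
    {ω | t * μ.real E + L / (n * t) < |empFrac E ω - μ.real E|} with hbad
  have hsub : {ω : Fin n → ℝ | ∃ x, t * (1 - cdfR μ x) + (L + 2) / (n * t)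
        < |empFrac (Ioi x) ω - (1 - cdfR μ x)|} ⊆
      ⋃ k ∈ Finset.range n, (bad (Ioi (T k)) ∪ bad (Ici (T k))) := by
    rintro ω ⟨x, hx⟩
    by_contra hcon
    simp only [mem_iUnion, not_exists, mem_union, not_or, Finset.mem_range] at hcon
    have hgood1 : ∀ k < n, |empFrac (Ioi (T k)) ω - (1 - cdfR μ (T k))| ≤
        t * (1 - cdfR μ (T k)) + L / (n * t) := fun k hk => by
      have := (hcon k hk).1
      simp only [hbad, mem_ofPred_eq, not_lt, measureReal_Ioi] at this
      exact this
    have hgood2 : ∀ k < n, |empFrac (Ici (T k)) ω - (1 - μ.real (Iio (T k)))| ≤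
        t * (1 - μ.real (Iio (T k))) + L / (n * t) := fun k hk => by
      have := (hcon k hk).2
      simp only [hbad, mem_ofPred_eq, not_lt] at this
      have e : μ.real (Ici (T k)) = 1 - μ.real (Iio (T k)) := by
        rw [← compl_Iio, probReal_compl_eq_one_sub measurableSet_Iio]
      rwa [e] at this
    refine absurd hx (not_lt.mpr ?_)
    obtain ⟨k, hkn, hk1, hk2, hk3⟩ := exists_cell hn (cdfR_nonneg μ x) (cdfR_le_one μ x)
    set F := cdfR μ x with hF
    have hF1 : F ≤ 1 := cdfR_le_one μ x
    have hsplit : (L + 2) / (n * t) = L / (n * t) + 2 / (n * t) := by ring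
    have hinv : 0 < 1 / (n : ℝ) := by positivity
    have h2 : 2 * (1 / (n : ℝ)) ≤ 2 / (n * t) := by
      rw [mul_one_div]
      exact div_le_div_of_nonneg_left (by norm_num) (by positivity) (by nlinarith)
    have hLn : 0 ≤ L / (n * t) := by positivity
    have hk4 : ((k + 1 : ℕ) : ℝ) / n = (k : ℝ) / n + 1 / n := by push_cast; ring
    rw [hk4] at hk2 hk3
    have hti : t * (1 / (n : ℝ)) ≤ 1 / n := by nlinarith
    have htF : 0 ≤ t * (1 - F) := mul_nonneg ht.le (by linarith)
    rw [abs_le, hsplit]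
    constructor
    · rcases Nat.lt_or_ge (k + 1) n with hk | hk
      · obtain ⟨hT1, hT2⟩ := hT (k + 1) (Nat.succ_pos k) hk
        have hxT : x < T (k + 1) := by
          by_contra! h
          have := (hT1 x).mpr h
          rw [hk4] at this
          exact absurd (hk3 hk) (not_lt.mpr this)
        have hm := empFrac_mono (Ici_subset_Ioi.mpr hxT) ω
        have hg := (abs_le.mp (hgood2 (k + 1) hk)).1
        rw [hk4] at hT2
        have : (1 - t) * (1 - F - 1 / n) ≤ (1 - t) * (1 - μ.real (Iio (T (k + 1)))) := by
          apply mul_le_mul_of_nonneg_left _ (by linarith)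
          linarith
        nlinarith
      · have hkn' : k + 1 = n := by omega
        have : (k : ℝ) / n = 1 - 1 / n := by
          have : (k : ℝ) = n - 1 := by rw [← hkn']; push_cast; ring
          rw [this]; field_simp
        have := empFrac_nonneg (Ioi x) ω
        linarith
    · rcases Nat.eq_zero_or_pos k with rfl | hk
      · have := empFrac_le_one (Ioi x) ω
        simp only [Nat.cast_zero, zero_div, zero_add] at hk2
        linarith
      · obtain ⟨hT1, hT2⟩ := hT k hk hkn
        have hxT : T k ≤ x := (hT1 x).mp hk1
        have hm := empFrac_mono (Ioi_subset_Ioi hxT) ω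
        have hg := (abs_le.mp (hgood1 k hkn)).2
        have hTT := (hT1 (T k)).mpr le_rfl
        have : (1 + t) * (1 - cdfR μ (T k)) ≤ (1 + t) * (1 - F + 1 / n) := by
          apply mul_le_mul_of_nonneg_left _ (by linarith)
          linarith
        nlinarith
  calc _ ≤ _ := measureReal_mono hsub (measure_ne_top _ _)
    _ ≤ ∑ k ∈ Finset.range n, (iidP μ n).real (bad (Ioi (T k)) ∪ bad (Ici (T k))) :=
        measureReal_biUnion_finset_le _ _
    _ ≤ ∑ _k ∈ Finset.range n, 4 * Real.exp (-L) := by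
        refine Finset.sum_le_sum fun k _ => (measureReal_union_le _ _).trans ?_
        have h1 := chernoff μ hn (measurableSet_Ioi (a := T k)) ht ht1 L
        have h2 := chernoff μ hn (measurableSet_Ici (a := T k)) ht ht1 L
        linarith
    _ = _ := by simp

/-- The empirical survival function of `ω` is close to that of `μ` at the points of `Q`, with a
sharper bound at those powers of two where the survival function of `μ` lies in `[lo, hi]`. -/
def CloseOn {n : ℕ} (t Λ B lo hi : ℝ) (Q : Set ℝ) (μ : Measure ℝ) (ω : Fin n → ℝ) : Prop :=
  ∀ x ∈ Q, |empFrac (Ioi x) ω - (1 - cdfR μ x)| ≤ t * (1 - cdfR μ x) + Λ / (n * t) ∧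
    ∀ k : ℕ, x = 2 ^ k → lo ≤ 1 - cdfR μ x → 1 - cdfR μ x ≤ hi →
      |empFrac (Ioi x) ω - (1 - cdfR μ x)| ≤ t * (1 - cdfR μ x) + B / (n * t)

lemma closeOn_prob (μ : Measure ℝ) [IsProbabilityMeasure μ] {n : ℕ} (hn : 0 < n)
    {t : ℝ} (ht : 0 < t) (ht1 : t ≤ 1) {L : ℝ} (hL : 0 ≤ L) (B : ℝ) {lo hi : ℝ} {M : ℕ}
    (hM : ∀ k k' : ℕ, k ≤ k' → 1 - cdfR μ (2 ^ k) ≤ hi → lo ≤ 1 - cdfR μ (2 ^ k') → k' ≤ k + M) :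
    (iidP μ n).real {ω | ¬ CloseOn t (L + 2) B lo hi univ μ ω}
      ≤ n * (4 * Real.exp (-L)) + (M + 1) * (2 * Real.exp (-B)) := by
  set T : Set ℕ := {k | lo ≤ 1 - cdfR μ (2 ^ k) ∧ 1 - cdfR μ (2 ^ k) ≤ hi} with hT
  have hTk : ∃ k₀, T ⊆ Finset.Icc k₀ (k₀ + M) := by
    by_cases hne : T.Nonempty
    · refine ⟨sInf T, fun k hk => ?_⟩
      have h0 := Nat.sInf_mem hne
      have h1 := Nat.sInf_le hk
      simp only [Finset.coe_Icc, mem_Icc]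
      exact ⟨h1, hM _ _ h1 h0.2 hk.1⟩
    · exact ⟨0, fun k hk => absurd ⟨k, hk⟩ hne⟩
  obtain ⟨k₀, hk₀⟩ := hTk
  have hsub : {ω : Fin n → ℝ | ¬ CloseOn t (L + 2) B lo hi univ μ ω} ⊆
      {ω | ∃ x, t * (1 - cdfR μ x) + (L + 2) / (n * t)
        < |empFrac (Ioi x) ω - (1 - cdfR μ x)|} ∪
      ⋃ k ∈ Finset.Icc k₀ (k₀ + M), {ω | t * μ.real (Ioi (2 ^ k)) + B / (n * t)
        < |empFrac (Ioi (2 ^ k)) ω - μ.real (Ioi (2 ^ k))|} := by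
    intro ω hω
    by_contra hcon
    simp only [mem_union, mem_iUnion, not_or, not_exists, mem_ofPred_eq, not_lt] at hcon
    refine hω fun x _ => ⟨hcon.1 x, fun k hk hlo hhi => ?_⟩
    subst hk
    have := hcon.2 k (hk₀ ⟨hlo, hhi⟩)
    rwa [measureReal_Ioi] at this
  calc _ ≤ _ := measureReal_mono hsub (measure_ne_top _ _)
    _ ≤ _ := measureReal_union_le _ _
    _ ≤ _ := add_le_add (uniform_chernoff μ hn ht ht1 hL) (measureReal_biUnion_finset_le _ _)
    _ ≤ n * (4 * Real.exp (-L)) + ∑ _k ∈ Finset.Icc k₀ (k₀ + M), 2 * Real.exp (-B) := by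
        gcongr with k
        exact chernoff μ hn measurableSet_Ioi ht ht1 B
    _ = _ := by
        simp only [Finset.sum_const, Nat.card_Icc, nsmul_eq_mul]
        congr 2
        have : k₀ + M + 1 - k₀ = M + 1 := by omega
        rw [this]; push_cast; rfl

/-- Far in the tail, the survival function of an element of the second order Pareto class is
comparable to `C * x ^ (-τ)`, uniformly over compact sets of parameters. -/
lemma SOP.tail_comparable {a b c₁ c₂ C' β : ℝ} (ha : 0 < a) (hc : 0 < c₁) (hC' : 0 < C')
    (hβ : 0 < β) :
    ∃ X : ℝ, 1 ≤ X ∧ ∀ τ ∈ Icc a b, ∀ C ∈ Icc c₁ c₂, ∀ μ ∈ SOP τ β C C', ∀ x, X ≤ x →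
      0 < cdfR μ x → C / 2 ≤ x ^ τ * (1 - cdfR μ x) ∧ x ^ τ * (1 - cdfR μ x) ≤ 3 * C / 2 := by
  have ht : Tendsto (fun x : ℝ => C' * x ^ (-(a * β))) atTop (nhds (C' * 0)) :=
    (tendsto_rpow_neg_atTop (mul_pos ha hβ)).const_mul C'
  rw [mul_zero] at ht
  obtain ⟨X, hX⟩ := eventually_atTop.mp
    (ht.eventually (Iio_mem_nhds (show (0 : ℝ) < c₁ / 2 by linarith)))
  refine ⟨max 1 X, le_max_left _ _, fun τ hτ C hC μ hμ x hx hF => ?_⟩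
  have hx1 : 1 ≤ x := (le_max_left _ _).trans hx
  have h1 : C' * x ^ (-(a * β)) < c₁ / 2 := hX x ((le_max_right _ _).trans hx)
  have h2 : x ^ (-(τ * β)) ≤ x ^ (-(a * β)) :=
    Real.rpow_le_rpow_of_exponent_le hx1 (by nlinarith [hτ.1])
  have h3 := abs_le.mp (SOP.weighted_bound hμ (by linarith) hF)
  have h4 : C' * x ^ (-(τ * β)) ≤ C' * x ^ (-(a * β)) := by gcongr
  have := hC.1
  constructor <;> linarith

/-- Only boundedly many powers of two have survival probability of a given small order. -/
lemma SOP.dyadic_count {a b c₁ c₂ C' β w₁ w₂ : ℝ} (ha : 0 < a) (hc : 0 < c₁) (hC' : 0 < C')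
    (hβ : 0 < β) (hw₁ : 0 < w₁) :
    ∃ M : ℕ, ∀ᶠ N : ℝ in atTop, ∀ τ ∈ Icc a b, ∀ C ∈ Icc c₁ c₂, ∀ μ ∈ SOP τ β C C',
      ∀ k k' : ℕ, k ≤ k' → 1 - cdfR μ (2 ^ k) ≤ w₂ / N → w₁ / N ≤ 1 - cdfR μ (2 ^ k') →
        k' ≤ k + M := by
  obtain ⟨X, hX1, hX⟩ := SOP.tail_comparable (b := b) (c₂ := c₂) ha hc hC' hβ
  obtain ⟨M, hM⟩ := pow_unbounded_of_one_lt (3 * w₂ / w₁)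
    (Real.one_lt_rpow (show (1 : ℝ) < 2 by norm_num) ha)
  have hXb : 0 < X ^ (-b) := Real.rpow_pos_of_pos (by linarith) _
  have hlim : Tendsto (fun N : ℝ => w₂ / N) atTop (nhds 0) :=
    tendsto_const_nhds.div_atTop tendsto_id
  refine ⟨M, ?_⟩
  filter_upwards [eventually_gt_atTop 0, hlim.eventually (Iio_mem_nhds one_pos),
    hlim.eventually (Iio_mem_nhds (show 0 < c₁ / 2 * X ^ (-b) by positivity))]
    with N hN hN1 hN2 τ hτ C hC μ hμ k k' hkk' hk hk'
  have hprob := hμ.1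
  have hF : 0 < cdfR μ (2 ^ k) := by
    have : w₂ / N < 1 := hN1
    linarith
  have hkX : X ≤ 2 ^ k := by
    by_contra! hlt
    have hmono := cdfR_mono μ hlt.le
    have h1 := (hX τ hτ C hC μ hμ X le_rfl (hF.trans_le hmono)).1
    have hXpos : 0 < X ^ (-τ) := Real.rpow_pos_of_pos (by linarith) _
    have h2 : X ^ (-b) ≤ X ^ (-τ) :=
      Real.rpow_le_rpow_of_exponent_le hX1 (by linarith [hτ.2])
    have e : X ^ (-τ) * (X ^ τ * (1 - cdfR μ X)) = 1 - cdfR μ X := by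
      rw [← mul_assoc, ← Real.rpow_add (by linarith)]; simp
    have h3 := mul_le_mul_of_nonneg_left h1 hXpos.le
    rw [e] at h3
    have h4 : c₁ / 2 * X ^ (-b) ≤ X ^ (-τ) * (C / 2) := by
      have := hC.1
      have hC2 : 0 ≤ C / 2 := by linarith
      calc c₁ / 2 * X ^ (-b) ≤ C / 2 * X ^ (-τ) := by gcongr
        _ = _ := by ring
    have : w₂ / N < c₁ / 2 * X ^ (-b) := hN2
    linarith
  have hkk2 : (2 : ℝ) ^ k ≤ 2 ^ k' := pow_le_pow_right₀ (by norm_num) hkk'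
  have h1 := (hX τ hτ C hC μ hμ _ hkX hF).1
  have h2 := (hX τ hτ C hC μ hμ _ (hkX.trans hkk2) (hF.trans_le (cdfR_mono μ hkk2))).2
  rw [← Real.rpow_pow_comm (by norm_num)] at h1 h2
  set s : ℝ := 2 ^ τ with hs
  have hs0 : 0 < s := Real.rpow_pos_of_pos (by norm_num) _
  have hsa : (2 : ℝ) ^ a ≤ s := Real.rpow_le_rpow_of_exponent_le (by norm_num) hτ.1
  have h3 : s ^ k' * (w₁ / N) ≤ 3 * (s ^ k * (w₂ / N)) := by
    calc s ^ k' * (w₁ / N) ≤ s ^ k' * (1 - cdfR μ (2 ^ k')) := by gcongr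
      _ ≤ 3 * (s ^ k * (1 - cdfR μ (2 ^ k))) := by linarith
      _ ≤ _ := by gcongr
  by_contra! hlt
  obtain ⟨d, rfl⟩ := Nat.exists_eq_add_of_le hkk'
  have h4 : s ^ d * w₁ ≤ 3 * w₂ := by
    have hk0 : 0 < s ^ k / N := by positivity
    refine le_of_mul_le_mul_left ?_ hk0
    calc s ^ k / N * (s ^ d * w₁) = s ^ (k + d) * (w₁ / N) := by rw [pow_add]; ring
      _ ≤ _ := h3
      _ = _ := by ring
  have h5 : ((2 : ℝ) ^ a) ^ M ≤ s ^ d :=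
    (pow_le_pow_left₀ (by positivity) hsa M).trans
      (pow_le_pow_right₀ ((Real.one_lt_rpow (by norm_num) ha).le.trans hsa) (by omega))
  rw [div_lt_iff₀ hw₁] at hM
  nlinarith

/-- The acceptance region: at every finite set of rational points, the empirical survival function
is close to that of some element of the null hypothesis `𝓗`. -/
def acceptRegion (𝓗 : Set (Measure ℝ)) (n : ℕ) (t Λ B lo hi : ℝ) : Set (Fin n → ℝ) :=
  {ω | ∀ Q : Finset ℚ, ∃ ν ∈ 𝓗, CloseOn t Λ B lo hi ((fun q : ℚ => (q : ℝ)) '' Q) ν ω}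

lemma measurableSet_of_empFrac_rat {n : ℕ} (Q : Finset ℚ) {S : Set (Fin n → ℝ)}
    (hS : ∀ ω ω', (∀ q ∈ Q, empFrac (Ioi (q : ℝ)) ω = empFrac (Ioi (q : ℝ)) ω') → ω ∈ S → ω' ∈ S) :
    MeasurableSet S := by
  let Φ : (Fin n → ℝ) → (Q → Fin n → Prop) := fun ω q i => ((q : ℚ) : ℝ) < ω i
  have hΦ : Measurable Φ := by
    refine measurable_pi_iff.mpr fun q => measurable_pi_iff.mpr fun i => ?_
    exact measurableSet_setOfPred.mp (measurableSet_lt measurable_const (measurable_pi_apply i))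
  have hpre : S = Φ ⁻¹' (Φ '' S) := by
    refine Subset.antisymm (subset_preimage_image Φ S) ?_
    rintro ω' ⟨ω, hω, he⟩
    refine hS ω ω' (fun q hq => ?_) hω
    unfold empFrac
    congr 1
    refine Finset.sum_congr rfl fun i _ => ?_
    have : ((q : ℝ) < ω i) = ((q : ℝ) < ω' i) := congrFun (congrFun he ⟨q, hq⟩) i
    by_cases h : (q : ℝ) < ω i
    · rw [indicator_of_mem (mem_Ioi.mpr h), indicator_of_mem (mem_Ioi.mpr (this ▸ h))]
    · rw [indicator_of_notMem (fun h' => h (mem_Ioi.mp h')),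
        indicator_of_notMem (fun h' => (this ▸ h) (mem_Ioi.mp h'))]
  rw [hpre]
  exact hΦ (MeasurableSet.of_discrete)

lemma measurableSet_acceptRegion (𝓗 : Set (Measure ℝ)) (n : ℕ) (t Λ B lo hi : ℝ) :
    MeasurableSet (acceptRegion 𝓗 n t Λ B lo hi) := by
  unfold acceptRegion
  rw [ofPred_forall]
  refine MeasurableSet.iInter fun Q => measurableSet_of_empFrac_rat Q ?_
  rintro ω ω' he ⟨ν, hν, hc⟩
  refine ⟨ν, hν, ?_⟩
  rintro _ ⟨q, hq, rfl⟩
  have := hc q ⟨q, hq, rfl⟩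
  rwa [he q hq] at this

/-- If the distance of `μ` to the smoother class is more than `r`, then the defining inequality of
that class is violated by at least `r` at a rational point which is not too close to the left end
of the support. -/
lemma SOP.exists_violation {τ β₁ β₀ C C' c₂ r : ℝ} {μ : Measure ℝ} (hτ : 0 < τ) (hβ₁ : 0 < β₁)
    (hβ₀ : 0 < β₀) (hC : 0 < C) (hCc : C ≤ c₂) (hC' : 0 < C') (hr : 0 < r)
    (hrE : r / (1 + 2 * (c₂ + C')) ≤ 1 / 2) (hμ : μ ∈ SOP τ β₁ C C')
    (hd : r < distToSet τ μ (SOP τ β₀ C C')) :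
    ∃ q : ℚ, 0 < (q : ℝ) ∧ r / (1 + 2 * (c₂ + C')) ≤ cdfR μ q ∧
      C' * (q : ℝ) ^ (-(τ * β₀)) + r < |(q : ℝ) ^ τ * (1 - cdfR μ q) - C| := by
  have hprob := hμ.1
  have hpos : ∀ x, 0 < cdfR μ x → 0 < x := fun x hF => SOP.pos_of_cdfR_pos hμ hτ hβ₁ hC hC' hF
  set E : ℝ := 1 + 2 * (c₂ + C') with hE
  have hE0 : 0 < E := by linarith
  have hθ : 0 < r / E := by positivity
  obtain ⟨x, hx0, hxF, hx⟩ : ∃ x : ℝ, 0 < x ∧ r / E ≤ cdfR μ x ∧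
      C' * x ^ (-(τ * β₀)) + r < |x ^ τ * (1 - cdfR μ x) - C| := by
    by_contra! hcon
    refine absurd (distToSet_le_of_band hτ hβ₀ hC hC' hr.le hθ (by linarith) hpos ?_ hcon)
      (not_le.mpr hd)
    intro x hF hFθ
    have hx0 := hpos x hF
    have hxE : x ^ τ ≤ E := by
      rcases le_total x 1 with hx1 | hx1
      · have := Real.rpow_le_one hx0.le hx1 hτ.le
        linarith
      · have h1 := (abs_le.mp (SOP.weighted_bound hμ hx0 hF)).2
        have h2 : x ^ (-(τ * β₁)) ≤ 1 :=
          Real.rpow_le_one_of_one_le_of_nonpos hx1 (by nlinarith)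
        have h3 : x ^ τ * (1 / 2) ≤ x ^ τ * (1 - cdfR μ x) := by
          gcongr; linarith
        nlinarith
    calc x ^ τ * cdfR μ x ≤ E * (r / E) := by gcongr
      _ = r := by field_simp
  have hcts : ContinuousWithinAt (fun y : ℝ => |y ^ τ * (1 - cdfR μ y) - C| -
      (C' * y ^ (-(τ * β₀)) + r)) (Ici x) x := by
    have h1 : ∀ p : ℝ, ContinuousWithinAt (fun y : ℝ => y ^ p) (Ici x) x := fun p =>
      (Real.continuousAt_rpow_const x p (Or.inl hx0.ne')).continuousWithinAt
    exact (((h1 τ).mul (continuousWithinAt_const.sub (cdfR_rightCts μ x))).sub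
      continuousWithinAt_const).abs.sub (((h1 _).const_mul C').add continuousWithinAt_const)
  have hev := (hcts.mono Ioi_subset_Ici_self).eventually (Ioi_mem_nhds (sub_pos.mpr hx))
  obtain ⟨u, hu, hsub⟩ := (mem_nhdsGT_iff_exists_Ioo_subset).mp hev
  obtain ⟨q, hq1, hq2⟩ := exists_rat_btwn (mem_Ioi.mp hu)
  refine ⟨q, hx0.trans hq1, hxF.trans (cdfR_mono μ hq1.le), ?_⟩
  exact sub_pos.mp (hsub ⟨hq1, hq2⟩)

lemma abs_log_sub_log_le {x y r : ℝ} (hy : 0 < y) (hr : r ≤ 1 / 2) (h : |x - y| ≤ r * y) :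
    |Real.log x - Real.log y| ≤ 2 * r := by
  obtain ⟨h1, h2⟩ := abs_le.mp h
  have hr0 : 0 ≤ r := nonneg_of_mul_nonneg_left ((abs_nonneg _).trans h) hy
  have hx : y / 2 ≤ x := by nlinarith
  have hx0 : 0 < x := by linarith
  rw [abs_le]
  constructor
  · have := Real.log_le_sub_one_of_pos (div_pos hy hx0)
    rw [Real.log_div hy.ne' hx0.ne'] at this
    have h3 : y / x - 1 ≤ 2 * r := by
      rw [sub_le_iff_le_add, div_le_iff₀ hx0]
      nlinarith
    linarith
  · have := Real.log_le_sub_one_of_pos (div_pos hx0 hy)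
    rw [Real.log_div hx0.ne' hy.ne'] at this
    have h3 : x / y - 1 ≤ r := by
      rw [sub_le_iff_le_add, div_le_iff₀ hy]
      linarith
    linarith

lemma exists_dyadic_scale {τ N : ℝ} (hτ : 0 < τ) (hN : 1 ≤ N) :
    ∃ k : ℕ, N ≤ ((2 : ℝ) ^ k) ^ τ ∧ ((2 : ℝ) ^ k) ^ τ ≤ 2 ^ τ * N := by
  obtain ⟨m, hm1, hm2⟩ :=
    exists_nat_pow_near hN (Real.one_lt_rpow (show (1 : ℝ) < 2 by norm_num) hτ)
  refine ⟨m + 1, ?_, ?_⟩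
  · rw [← Real.rpow_pow_comm (by norm_num)]
    exact hm2.le
  · rw [← Real.rpow_pow_comm (by norm_num), pow_succ']
    gcongr

lemma abs_sub_le_of_crude {h g l u δ ε η : ℝ} (hl : 0 < l) (hlh : l ≤ h) (hhu : h ≤ u)
    (hg : 0 ≤ g) (hδ : 0 ≤ δ) (hδ1 : δ ≤ 1 / 8) (hε : ε ≤ l / 8) (hη : 0 ≤ η)
    (hcr : |h - g| ≤ δ * (h + g) + ε)
    (hre : l / 2 ≤ h → h ≤ 2 * u → l / 2 ≤ g → g ≤ 2 * u → |h - g| ≤ δ * (h + g) + η * l) :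
    0 < g ∧ g ≤ 2 * u ∧ |g - h| ≤ (3 * δ + η) * h := by
  have k1 : δ * (h + g) ≤ 1 / 8 * (h + g) := by gcongr; linarith
  obtain ⟨n1, n2⟩ := abs_le.mp hcr
  have hre' := hre (by linarith) (by linarith) (by linarith) (by linarith)
  refine ⟨by linarith, by linarith, ?_⟩
  rw [abs_sub_comm]
  have k2 : δ * (h + g) ≤ δ * (3 * h) := by gcongr; linarith
  have k3 : η * l ≤ η * h := by gcongr
  linarith

lemma SOP.log_survival_close {τ β C C' c η q : ℝ} {μ : Measure ℝ} (hμ : μ ∈ SOP τ β C C')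
    (hq : 0 < q) (hF : 0 < cdfR μ q) (hc : 0 < c) (hC : c ≤ C) (hη : η ≤ 1 / 2)
    (h : C' * (q ^ τ) ^ (-β) ≤ η * c) :
    |q ^ τ * (1 - cdfR μ q) - C| ≤ η * C ∧
      |τ * Real.log q + Real.log (1 - cdfR μ q) - Real.log C| ≤ 2 * η := by
  have h1 := SOP.weighted_bound hμ hq hF
  rw [neg_mul_eq_mul_neg, Real.rpow_mul hq.le] at h1
  have hY : 0 < q ^ τ := Real.rpow_pos_of_pos hq τ
  have hη0 : 0 ≤ η := nonneg_of_mul_nonneg_left (((abs_nonneg _).trans h1).trans h) hc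
  have h2 : |q ^ τ * (1 - cdfR μ q) - C| ≤ η * C := h1.trans (h.trans (by gcongr))
  have hH : 0 < 1 - cdfR μ q := by
    refine pos_of_mul_pos_right ?_ hY.le
    have := (abs_le.mp h2).1
    nlinarith
  have h3 := abs_log_sub_log_le (hc.trans_le hC) hη h2
  rw [Real.log_mul hY.ne' hH.ne', Real.log_rpow hq] at h3
  exact ⟨h2, h3⟩

/-- At a point where the survival functions of `μ` and `ν` are both of order `1 / N` and
sufficiently close, the parameters of `μ` and `ν` satisfy an approximate linear relation. -/
lemma SOP.log_relation {a b c₁ c₂ C' β₁ β₀ A B W : ℝ} (ha : 0 < a) (hc : 0 < c₁) (hcc : c₁ ≤ c₂)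
    (hC' : 0 < C') (hβ₁ : 0 < β₁) (hβ : β₁ ≤ β₀) (hab : a ≤ b) (hB : 0 ≤ B) (hW : 0 < W) :
    ∃ κ : ℝ, 0 < κ ∧ ∀ᶠ N : ℝ in atTop, ∀ τ ∈ Icc a b, ∀ C ∈ Icc c₁ c₂, ∀ μ ∈ SOP τ β₁ C C',
      ∀ τ₀ ∈ Icc a b, ∀ C₀ ∈ Icc c₁ c₂, ∀ ν ∈ SOP τ₀ β₀ C₀ C', ∀ q : ℝ, 0 < q →
      N ≤ q ^ τ → q ^ τ ≤ W * N → 0 < cdfR μ q → 0 < cdfR ν q →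
      |(1 - cdfR μ q) - (1 - cdfR ν q)| ≤ N ^ (-β₁) * ((1 - cdfR μ q) + (1 - cdfR ν q)) +
        A * (N ^ (-β₁) * Real.log N) / N →
      (c₁ / (4 * W) / N ≤ 1 - cdfR μ q → 1 - cdfR μ q ≤ 3 * c₂ / N →
        c₁ / (4 * W) / N ≤ 1 - cdfR ν q → 1 - cdfR ν q ≤ 3 * c₂ / N →
        |(1 - cdfR μ q) - (1 - cdfR ν q)| ≤ N ^ (-β₁) * ((1 - cdfR μ q) + (1 - cdfR ν q)) +
          B * N ^ (-β₁) / N) →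
      |Real.log C₀ - Real.log C - (τ₀ - τ) * Real.log q| ≤ κ * N ^ (-β₁) := by
  have hc₂ : 0 < c₂ := by linarith
  have hβ₀ : 0 < β₀ := by linarith
  have hb : 0 < b := by linarith
  set V : ℝ := (c₁ / (6 * c₂)) ^ (-β₀) with hV
  have hV0 : 0 < V := Real.rpow_pos_of_pos (by positivity) _
  set κ₁ : ℝ := 3 + 2 * W * B / c₁ with hκ₁
  have hκ₁0 : 0 < κ₁ := by positivity
  have hδlim : Tendsto (fun N : ℝ => N ^ (-β₁)) atTop (nhds 0) := tendsto_rpow_neg_atTop hβ₁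
  have hmul : ∀ c : ℝ, Tendsto (fun N : ℝ => c * N ^ (-β₁)) atTop (nhds 0) := fun c => by
    simpa using hδlim.const_mul c
  have hlog : Tendsto (fun N : ℝ => A * (N ^ (-β₁) * Real.log N)) atTop (nhds 0) := by
    have := (isLittleO_log_rpow_atTop hβ₁).tendsto_div_nhds_zero
    have h2 : Tendsto (fun N : ℝ => N ^ (-β₁) * Real.log N) atTop (nhds 0) := by
      refine this.congr' ?_
      filter_upwards [eventually_gt_atTop 0] with N hN
      rw [Real.rpow_neg hN.le, div_eq_mul_inv, mul_comm]
    simpa using h2.const_mul A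
  have hs : Tendsto (fun N : ℝ => C' * N ^ (-(a / b * β₀))) atTop (nhds 0) := by
    simpa using (tendsto_rpow_neg_atTop (show 0 < a / b * β₀ by positivity)).const_mul C'
  refine ⟨2 * (C' * V / c₁) + 2 * κ₁ + 2 * (C' / c₁), by positivity, ?_⟩
  filter_upwards [eventually_ge_atTop 1,
    hδlim.eventually (Iio_mem_nhds (show (0 : ℝ) < 1 / 8 by norm_num)),
    (hmul (C' / c₁)).eventually (Iio_mem_nhds (show (0 : ℝ) < 1 / 2 by norm_num)),
    (hmul κ₁).eventually (Iio_mem_nhds (show (0 : ℝ) < 1 / 2 by norm_num)),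
    (hmul (C' * V / c₁)).eventually (Iio_mem_nhds (show (0 : ℝ) < 1 / 2 by norm_num)),
    hlog.eventually (Iio_mem_nhds (show (0 : ℝ) < c₁ / (16 * W) by positivity)),
    hs.eventually (Iio_mem_nhds (show (0 : ℝ) < c₁ / 2 by positivity))]
    with N hN e1 e2 e3 e4 e5 e6 τ hτ C hC μ hμ τ₀ hτ₀ C₀ hC₀ ν hν q hq hqN hqW hF hG hcr hre
  have hN0 : 0 < N := by linarith
  set δ : ℝ := N ^ (-β₁) with hδ
  have hδ0 : 0 < δ := Real.rpow_pos_of_pos hN0 _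
  obtain ⟨hτa, hτb⟩ := hτ
  obtain ⟨hτ₀a, hτ₀b⟩ := hτ₀
  obtain ⟨hCl, hCu⟩ := hC
  obtain ⟨hC₀l, hC₀u⟩ := hC₀
  have hCpos : 0 < C := by linarith
  have hq1 : 1 ≤ q := by
    by_contra! hlt
    have := Real.rpow_lt_one hq.le hlt (show 0 < τ by linarith)
    linarith
  have hYδ : C' * (q ^ τ) ^ (-β₁) ≤ C' / c₁ * δ * c₁ := by
    calc C' * (q ^ τ) ^ (-β₁) ≤ C' * δ := by
          gcongr
          exact Real.rpow_le_rpow_of_nonpos hN0 hqN (by linarith)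
      _ = _ := by field_simp
  obtain ⟨hμ1, l1⟩ := SOP.log_survival_close hμ hq hF hc hCl e2.le hYδ
  obtain ⟨m1, m2⟩ := abs_le.mp hμ1
  have e2C : C' / c₁ * δ * C ≤ 1 / 2 * C := by gcongr
  have hg0 : 0 ≤ 1 - cdfR ν q := by
    have := hν.1
    linarith [cdfR_le_one ν q]
  have hh0 : 0 < 1 - cdfR μ q :=
    pos_of_mul_pos_right (show 0 < q ^ τ * (1 - cdfR μ q) by linarith) (by linarith)
  have hhl : c₁ / (2 * W) / N ≤ 1 - cdfR μ q := by
    rw [div_div, div_le_iff₀ (by positivity)]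
    have := mul_le_mul_of_nonneg_right hqW hh0.le
    linarith
  have hhu : 1 - cdfR μ q ≤ 3 * c₂ / 2 / N := by
    rw [le_div_iff₀ hN0]
    have := mul_le_mul_of_nonneg_right hqN hh0.le
    linarith
  have hε : A * (δ * Real.log N) / N ≤ c₁ / (2 * W) / N / 8 := by
    calc A * (δ * Real.log N) / N ≤ c₁ / (16 * W) / N := by gcongr
      _ = _ := by ring
  have hw1 : c₁ / (4 * W) / N = c₁ / (2 * W) / N / 2 := by ring
  have hw2 : 3 * c₂ / N = 2 * (3 * c₂ / 2 / N) := by ring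
  have hw3 : B * δ / N = 2 * W * B / c₁ * δ * (c₁ / (2 * W) / N) := by field_simp
  rw [hw1, hw2, hw3] at hre
  obtain ⟨hgpos, hgu, href⟩ := abs_sub_le_of_crude (by positivity) hhl hhu hg0 hδ0.le e1.le hε
    (by positivity) hcr hre
  have hκe : 3 * δ + 2 * W * B / c₁ * δ = κ₁ * δ := by rw [hκ₁]; ring
  rw [hκe] at href
  have hYs : N ^ (a / b) ≤ q ^ τ₀ := by
    calc N ^ (a / b) ≤ (q ^ τ) ^ (a / b) := by gcongr
      _ = q ^ (τ * (a / b)) := (Real.rpow_mul hq.le _ _).symm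
      _ ≤ q ^ τ₀ := by
        refine Real.rpow_le_rpow_of_exponent_le hq1 ?_
        calc τ * (a / b) ≤ b * (a / b) := by gcongr
          _ = a := by field_simp
          _ ≤ τ₀ := hτ₀a
  have hY₀l : c₁ / (6 * c₂) * N ≤ q ^ τ₀ := by
    have k1 : C' * (q ^ τ₀) ^ (-β₀) ≤ 1 / 2 * c₁ := by
      calc C' * (q ^ τ₀) ^ (-β₀) ≤ C' * N ^ (-(a / b * β₀)) := by
            rw [neg_mul_eq_mul_neg, Real.rpow_mul hN0.le]
            gcongr C' * ?_
            exact Real.rpow_le_rpow_of_nonpos (Real.rpow_pos_of_pos hN0 _) hYs (by linarith)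
        _ ≤ _ := by linarith
    have k2 := (abs_le.mp (SOP.log_survival_close hν hq hG hc hC₀l le_rfl k1).1).1
    have hY₀0 : 0 ≤ q ^ τ₀ := Real.rpow_nonneg hq.le _
    have k3 : c₁ / 2 ≤ q ^ τ₀ * (1 - cdfR ν q) := by linarith
    have k5 : c₁ / 2 ≤ q ^ τ₀ * (3 * c₂ / N) := by
      refine k3.trans (mul_le_mul_of_nonneg_left (hgu.trans hw2.ge) hY₀0)
    rw [← mul_div_assoc, le_div_iff₀ hN0] at k5
    rw [div_mul_eq_mul_div, div_le_iff₀ (by positivity)]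
    linarith
  have hν1 : C' * (q ^ τ₀) ^ (-β₀) ≤ C' * V / c₁ * δ * c₁ := by
    have k1 : (q ^ τ₀) ^ (-β₀) ≤ V * δ := by
      calc (q ^ τ₀) ^ (-β₀) ≤ (c₁ / (6 * c₂) * N) ^ (-β₀) :=
            Real.rpow_le_rpow_of_nonpos (by positivity) hY₀l (by linarith)
        _ = V * N ^ (-β₀) := Real.mul_rpow (by positivity) hN0.le
        _ ≤ V * δ := by
          gcongr
          exact Real.rpow_le_rpow_of_exponent_le hN (by linarith)
    calc C' * (q ^ τ₀) ^ (-β₀) ≤ C' * (V * δ) := by gcongr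
      _ = _ := by field_simp
  have l2 := abs_log_sub_log_le hh0 e3.le href
  have l3 := (SOP.log_survival_close hν hq hG hc hC₀l e4.le hν1).2
  rw [abs_le] at l1 l2 l3 ⊢
  constructor <;> linarith

lemma abs_slope_le_of_consecutive {s x ε : ℝ} {k : ℕ}
    (h₁ : |x - s * Real.log (2 ^ k)| ≤ ε) (h₂ : |x - s * Real.log (2 ^ (k + 1))| ≤ ε) :
    |s| ≤ 4 * ε ∧ |x| ≤ ε * (1 + 4 * Real.log (2 ^ k)) := by
  have hk0 : 0 ≤ Real.log ((2 : ℝ) ^ k) := Real.log_nonneg (one_le_pow₀ (by norm_num))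
  have hε : 0 ≤ ε := (abs_nonneg _).trans h₁
  have hs : |s| ≤ 4 * ε := by
    have h3 : |s * Real.log 2| ≤ 2 * ε := by
      rw [pow_succ, Real.log_mul (by positivity) (by norm_num)] at h₂
      rw [abs_le] at *
      constructor <;> linarith
    have h4 : (1 : ℝ) / 2 ≤ Real.log 2 := by linarith [Real.log_two_gt_d9]
    rw [abs_mul, abs_of_nonneg (show 0 ≤ Real.log 2 by linarith)] at h3
    nlinarith [abs_nonneg s]
  refine ⟨hs, ?_⟩
  have h5 : |s * Real.log (2 ^ k)| ≤ 4 * ε * Real.log (2 ^ k) := by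
    rw [abs_mul, abs_of_nonneg hk0]; gcongr
  calc |x| = |(x - s * Real.log (2 ^ k)) + s * Real.log (2 ^ k)| := by ring_nf
    _ ≤ ε + 4 * ε * Real.log (2 ^ k) := (abs_add_le _ _).trans (by gcongr)
    _ = _ := by ring

lemma abs_sub_le_of_abs_log_sub_le {x y c r : ℝ} (hx : 0 < x) (hy : 0 < y) (hyc : y ≤ c)
    (hr : r ≤ 1) (h : |Real.log x - Real.log y| ≤ r) : |x - y| ≤ 2 * c * r := by
  have h1 := Real.abs_exp_sub_one_le (h.trans hr)
  rw [Real.exp_sub, Real.exp_log hx, Real.exp_log hy] at h1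
  have h2 : x - y = y * (x / y - 1) := by field_simp
  rw [h2, abs_mul, abs_of_pos hy]
  have hc : 0 < c := by linarith
  calc y * |x / y - 1| ≤ c * (2 * |Real.log x - Real.log y|) := by gcongr
    _ ≤ c * (2 * r) := by gcongr
    _ = _ := by ring

lemma abs_rpow_sub_one_le {q s r : ℝ} (hq : 0 < q) (h : |s * Real.log q| ≤ r) (hr : r ≤ 1) :
    |q ^ s - 1| ≤ 2 * r := by
  rw [Real.rpow_def_of_pos hq, mul_comm]
  exact (Real.abs_exp_sub_one_le (h.trans hr)).trans (by gcongr)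

/-- If the survival functions `H` and `H'` are close at `q`, and so are the corresponding
parameters, then the second order bound on `H'` transfers to `H`. -/
lemma second_order_transfer {q τ τ₀ β₀ C C₀ C' H H' N δ A T η κ κ' : ℝ} (hq : 1 ≤ q) (hτ : 0 < τ)
    (hβ₀ : 0 < β₀) (hC' : 0 < C') (hN : 0 < N) (hqN : q ^ τ ≤ N) (hδ : 0 ≤ δ) (hδ1 : δ ≤ 1 / 2)
    (hδη : δ ≤ η) (hη : η ≤ 1) (hA : 0 ≤ A) (hH : 0 ≤ H) (hH' : 0 ≤ H') (hT : q ^ τ * H ≤ T)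
    (hcr : |H - H'| ≤ δ * (H + H') + A * η / N) (hz : |(τ₀ - τ) * Real.log q| ≤ κ * η)
    (hκ : κ * η ≤ 1) (hκβ : β₀ * (κ * η) ≤ 1) (hCC : |C₀ - C| ≤ κ' * η)
    (hν : |q ^ τ₀ * H' - C₀| ≤ C' * q ^ (-(τ₀ * β₀))) :
    |q ^ τ * H - C| ≤ C' * q ^ (-(τ * β₀)) +
      (T + (3 * T + 2 * A) + A + 2 * (3 * T + 2 * A) * κ + 2 * C' * β₀ * κ + κ') * η := by
  have hq0 : 0 < q := by linarith
  have hY : 0 < q ^ τ := Real.rpow_pos_of_pos hq0 _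
  have hη0 : 0 ≤ η := hδ.trans hδη
  have hP : |q ^ τ * H - q ^ τ * H'| ≤ δ * (q ^ τ * H + q ^ τ * H') + A * η := by
    rw [← mul_sub, abs_mul, abs_of_pos hY]
    calc q ^ τ * |H - H'| ≤ q ^ τ * (δ * (H + H') + A * η / N) := by gcongr
      _ = δ * (q ^ τ * H + q ^ τ * H') + (A * η) * (q ^ τ / N) := by ring
      _ ≤ δ * (q ^ τ * H + q ^ τ * H') + (A * η) * 1 := by
        gcongr
        exact (div_le_one hN).mpr hqN
      _ = _ := by ring
  have e0 : q ^ τ₀ = q ^ (τ₀ - τ) * q ^ τ := by rw [← Real.rpow_add hq0]; congr 1; ring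
  have e1 : q ^ (-(τ₀ * β₀)) = q ^ (-(τ₀ - τ) * β₀) * q ^ (-(τ * β₀)) := by
    rw [← Real.rpow_add hq0]; congr 1; ring
  have r1 := abs_rpow_sub_one_le hq0 hz hκ
  have r2 : |q ^ (-(τ₀ - τ) * β₀) - 1| ≤ 2 * (β₀ * (κ * η)) := by
    refine abs_rpow_sub_one_le hq0 ?_ hκβ
    rw [show -(τ₀ - τ) * β₀ * Real.log q = -(β₀ * ((τ₀ - τ) * Real.log q)) by ring, abs_neg,
      abs_mul, abs_of_pos hβ₀]
    gcongr
  rw [e0, e1] at hν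
  have hZ0 : 0 < q ^ (-(τ * β₀)) := Real.rpow_pos_of_pos hq0 _
  have hZ1 : q ^ (-(τ * β₀)) ≤ 1 :=
    Real.rpow_le_one_of_one_le_of_nonpos hq (neg_nonpos.mpr (by positivity))
  set P := q ^ τ * H with hPdef
  set P' := q ^ τ * H' with hP'def
  set Z := q ^ (-(τ * β₀)) with hZdef
  set s := q ^ (τ₀ - τ)
  set s' := q ^ (-(τ₀ - τ) * β₀)
  have hP0 : 0 ≤ P := by positivity
  have hP'0 : 0 ≤ P' := by positivity
  have hAη : A * η ≤ A := mul_le_of_le_one_right hA hη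
  have hP'T : P' ≤ 3 * T + 2 * A := by
    have h1 : δ * (P + P') ≤ 1 / 2 * (P + P') := by gcongr
    linarith [(abs_le.mp hP).1]
  have b1 : δ * (P + P') ≤ η * (T + (3 * T + 2 * A)) := by gcongr
  have b2 : |s * P' - P'| ≤ (3 * T + 2 * A) * (2 * (κ * η)) := by
    rw [show s * P' - P' = P' * (s - 1) by ring, abs_mul, abs_of_nonneg hP'0]
    gcongr
    linarith
  have b3 : C' * (s' * Z) ≤ C' * Z + C' * (2 * (β₀ * (κ * η))) := by
    have h1 : s' * Z ≤ Z + 2 * (β₀ * (κ * η)) := by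
      have h2 : (s' - 1) * Z ≤ 2 * (β₀ * (κ * η)) * 1 :=
        mul_le_mul ((le_abs_self _).trans r2) hZ1 hZ0.le ((abs_nonneg _).trans r2)
      linarith
    calc C' * (s' * Z) ≤ C' * (Z + 2 * (β₀ * (κ * η))) := by gcongr
      _ = _ := by ring
  rw [mul_assoc, ← hP'def] at hν
  rw [abs_le] at *
  constructor <;> linarith

lemma SOP.violation_location {τ β₁ β₀ C C' r N q : ℝ} {μ : Measure ℝ} (hτ : 0 < τ) (hβ₁ : 0 < β₁)
    (hβ : β₁ < β₀) (hC' : 0 < C') (hN : 0 < N) (hr : C' * N ^ (-β₁) ≤ r) (hμ : μ ∈ SOP τ β₁ C C')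
    (hq0 : 0 < q) (hF : 0 < cdfR μ q)
    (hq : C' * q ^ (-(τ * β₀)) + r < |q ^ τ * (1 - cdfR μ q) - C|) :
    1 ≤ q ∧ q ^ τ ≤ N ∧ q ^ τ * (1 - cdfR μ q) ≤ C + C' := by
  have hwμ := SOP.weighted_bound hμ hq0 hF
  have hN' : 0 < C' * N ^ (-β₁) := mul_pos hC' (Real.rpow_pos_of_pos hN _)
  have hq1 : 1 ≤ q := by
    by_contra! hlt
    have : q ^ (-(τ * β₁)) ≤ q ^ (-(τ * β₀)) :=
      Real.rpow_le_rpow_of_exponent_ge hq0 hlt.le (by nlinarith)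
    nlinarith
  refine ⟨hq1, ?_, ?_⟩
  · by_contra! hlt
    have h1 : C' * q ^ (-(τ * β₁)) ≤ C' * N ^ (-β₁) := by
      rw [neg_mul_eq_mul_neg, Real.rpow_mul hq0.le]
      gcongr C' * ?_
      exact Real.rpow_le_rpow_of_nonpos hN hlt.le (by linarith)
    have h4 : 0 < C' * q ^ (-(τ * β₀)) := mul_pos hC' (Real.rpow_pos_of_pos hq0 _)
    linarith
  · have h1 : q ^ (-(τ * β₁)) ≤ 1 :=
      Real.rpow_le_one_of_one_le_of_nonpos hq1 (neg_nonpos.mpr (by positivity))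
    have := mul_le_mul_of_nonneg_left h1 hC'.le
    linarith [(abs_le.mp hwμ).2]

lemma exists_consecutive_dyadic_scale {τ a b N : ℝ} (ha : 0 < a) (hτ : τ ∈ Icc a b) (hN : 1 ≤ N)
    (hℓ : 1 ≤ Real.log N) :
    ∃ k : ℕ, N ≤ ((2 : ℝ) ^ k) ^ τ ∧ ((2 : ℝ) ^ k) ^ τ ≤ 4 ^ b * N ∧
      N ≤ ((2 : ℝ) ^ (k + 1)) ^ τ ∧ ((2 : ℝ) ^ (k + 1)) ^ τ ≤ 4 ^ b * N ∧
      Real.log (2 ^ k) ≤ (Real.log (4 ^ b) + 1) / a * Real.log N := by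
  have hτ0 : 0 < τ := ha.trans_le hτ.1
  have hN0 : 0 < N := by linarith
  have hW1 : (1 : ℝ) ≤ 4 ^ b := Real.one_le_rpow (by norm_num) (hτ0.le.trans hτ.2)
  obtain ⟨k, hk1, hk2⟩ := exists_dyadic_scale hτ0 hN
  have h2τ : (2 : ℝ) ^ τ * 2 ^ τ ≤ 4 ^ b := by
    rw [← Real.mul_rpow (by norm_num) (by norm_num), show (2 : ℝ) * 2 = 4 by norm_num]
    exact Real.rpow_le_rpow_of_exponent_le (by norm_num) hτ.2
  have h2τ1 : (1 : ℝ) ≤ 2 ^ τ := Real.one_le_rpow (by norm_num) hτ0.le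
  have hk3 : ((2 : ℝ) ^ (k + 1)) ^ τ = 2 ^ τ * (2 ^ k) ^ τ := by
    rw [pow_succ', Real.mul_rpow (by norm_num) (by positivity)]
  have h2τb : (2 : ℝ) ^ τ ≤ 4 ^ b := by nlinarith
  have hk2' : ((2 : ℝ) ^ k) ^ τ ≤ 4 ^ b * N := hk2.trans (by gcongr)
  refine ⟨k, hk1, hk2', ?_, ?_, ?_⟩
  · rw [hk3]; nlinarith
  · rw [hk3]
    calc (2 : ℝ) ^ τ * (2 ^ k) ^ τ ≤ 2 ^ τ * (2 ^ τ * N) := by gcongr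
      _ = 2 ^ τ * 2 ^ τ * N := by ring
      _ ≤ _ := by gcongr
  · have h1 := Real.log_le_log (by positivity) hk2'
    rw [Real.log_rpow (by positivity), Real.log_mul (by positivity) hN0.ne'] at h1
    have h0 : 0 ≤ Real.log ((2 : ℝ) ^ k) :=
      Real.log_nonneg (one_le_pow₀ one_le_two)
    have hlogW : 0 ≤ Real.log (4 ^ b) := Real.log_nonneg hW1
    rw [div_mul_eq_mul_div, le_div_iff₀ ha]
    nlinarith [hτ.1]

/-- The null and the alternative hypotheses can be told apart from approximate knowledge of the
survival function at finitely many rational points. -/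
lemma SOP.exists_separating_points {a b c₁ c₂ C' β₁ β₀ A B : ℝ} (ha : 0 < a) (hab : a ≤ b)
    (hc : 0 < c₁) (hcc : c₁ ≤ c₂) (hC' : 0 < C') (hβ₁ : 0 < β₁) (hβ : β₁ < β₀) (hA : 0 ≤ A)
    (hB : 0 ≤ B) :
    ∃ K : ℝ, 0 < K ∧ ∀ᶠ N : ℝ in atTop, ∀ τ ∈ Icc a b, ∀ C ∈ Icc c₁ c₂, ∀ μ ∈ SOP τ β₁ C C',
      K * (N ^ (-β₁) * Real.log N) ≤ distToSet τ μ (SOP τ β₀ C C') →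
      ∃ Q : Finset ℚ, ∀ τ₀ ∈ Icc a b, ∀ C₀ ∈ Icc c₁ c₂, ∀ ν ∈ SOP τ₀ β₀ C₀ C',
        ¬ ∀ q ∈ Q,
          |(1 - cdfR μ q) - (1 - cdfR ν q)| ≤ N ^ (-β₁) * ((1 - cdfR μ q) + (1 - cdfR ν q)) +
            A * (N ^ (-β₁) * Real.log N) / N ∧
          ∀ k : ℕ, (q : ℝ) = 2 ^ k →
            c₁ / (4 * 4 ^ b) / N ≤ 1 - cdfR μ q → 1 - cdfR μ q ≤ 3 * c₂ / N →
            c₁ / (4 * 4 ^ b) / N ≤ 1 - cdfR ν q → 1 - cdfR ν q ≤ 3 * c₂ / N →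
            |(1 - cdfR μ q) - (1 - cdfR ν q)| ≤ N ^ (-β₁) * ((1 - cdfR μ q) + (1 - cdfR ν q)) +
              B * N ^ (-β₁) / N := by
  have hc₂ : 0 < c₂ := by linarith
  have hβ₀ : 0 < β₀ := by linarith
  have hb : 0 < b := by linarith
  have hW : (0 : ℝ) < 4 ^ b := Real.rpow_pos_of_pos (by norm_num) b
  have hW1 : (1 : ℝ) ≤ 4 ^ b := Real.one_le_rpow (by norm_num) hb.le
  obtain ⟨κ, hκ, hrel⟩ := SOP.log_relation (A := A) (B := B) ha hc hcc hC' hβ₁ hβ.le hab hB hW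
  obtain ⟨E, hE⟩ : ∃ E, E = 1 + 2 * (c₂ + C') := ⟨_, rfl⟩
  obtain ⟨κ', hκ'⟩ : ∃ κ', κ' = κ * (1 + 4 * ((Real.log (4 ^ b) + 1) / a)) := ⟨_, rfl⟩
  obtain ⟨Kc, hKc⟩ : ∃ Kc, Kc = (c₂ + C') + (3 * (c₂ + C') + 2 * A) + A +
    2 * (3 * (c₂ + C') + 2 * A) * (4 * κ / a) + 2 * C' * β₀ * (4 * κ / a) + 2 * c₂ * κ' := ⟨_, rfl⟩
  have hE0 : 0 < E := by rw [hE]; positivity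
  have hlogW : 0 ≤ Real.log (4 ^ b) := Real.log_nonneg hW1
  have hκ'0 : 0 < κ' := by rw [hκ']; positivity
  have hKc0 : 0 < Kc := by rw [hKc]; positivity
  obtain ⟨K, hK1, hK2, hK3⟩ : ∃ K, 2 * C' ≤ K ∧ 2 * E * (2 + A) < K ∧ 2 * Kc ≤ K := by
    have : 0 ≤ 2 * E * (2 + A) := by positivity
    refine ⟨1 + 2 * C' + 2 * E * (2 + A) + 2 * Kc, ?_, ?_, ?_⟩ <;> linarith
  have hK0 : 0 < K := by linarith
  refine ⟨K, hK0, ?_⟩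
  have hδlim : Tendsto (fun N : ℝ => N ^ (-β₁)) atTop (nhds 0) := tendsto_rpow_neg_atTop hβ₁
  have hη : ∀ c : ℝ, Tendsto (fun N : ℝ => c * (N ^ (-β₁) * Real.log N)) atTop (nhds 0) := by
    intro c
    have h2 : Tendsto (fun N : ℝ => N ^ (-β₁) * Real.log N) atTop (nhds 0) := by
      refine (isLittleO_log_rpow_atTop hβ₁).tendsto_div_nhds_zero.congr' ?_
      filter_upwards [eventually_gt_atTop 0] with N hN
      rw [Real.rpow_neg hN.le, div_eq_mul_inv, mul_comm]
    simpa using h2.const_mul c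
  filter_upwards [hrel, eventually_ge_atTop 1, Real.tendsto_log_atTop.eventually_ge_atTop 1,
    hδlim.eventually (Iio_mem_nhds (show (0 : ℝ) < 1 / 2 by norm_num)),
    (hη 1).eventually (Iio_mem_nhds one_pos),
    (hη (K / (2 * E))).eventually (Iio_mem_nhds (show (0 : ℝ) < 1 / 2 by norm_num)),
    (hη (4 * κ / a)).eventually (Iio_mem_nhds one_pos),
    (hη (β₀ * (4 * κ / a))).eventually (Iio_mem_nhds one_pos),
    (hη κ').eventually (Iio_mem_nhds one_pos)]
    with N hrelN hN hℓ e1 e2 e3 e4 e5 e6 τ hτ C hC μ hμ hd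
  clear hη hδlim hrel
  have hN0 : 0 < N := by linarith
  obtain ⟨η, hηd⟩ : ∃ η, η = N ^ (-β₁) * Real.log N := ⟨_, rfl⟩
  simp only [← hηd] at hrelN e2 e3 e4 e5 e6 hd ⊢
  have hδ0 : 0 < N ^ (-β₁) := Real.rpow_pos_of_pos hN0 _
  have hδη : N ^ (-β₁) ≤ η := by rw [hηd]; exact le_mul_of_one_le_right hδ0.le hℓ
  have hη0 : 0 < η := hδ0.trans_le hδη
  have hτ0 : 0 < τ := ha.trans_le hτ.1
  have hC0 : 0 < C := hc.trans_le hC.1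
  have hprob := hμ.1
  have hr0 : 0 < K * η / 2 := by positivity
  have hrE : K * η / 2 / E ≤ 1 / 2 := by
    calc K * η / 2 / E = K / (2 * E) * η := by field_simp
      _ ≤ _ := e3.le
  obtain ⟨q, hq0, hqF, hq⟩ := SOP.exists_violation hτ0 hβ₁ hβ₀ hC0 hC.2 hC' hr0 (hE ▸ hrE) hμ
    (lt_of_lt_of_le (by linarith [mul_pos hK0 hη0]) hd)
  rw [← hE] at hqF
  have hθ : (2 + A) * η < K * η / 2 / E := by
    rw [lt_div_iff₀ hE0]
    have := mul_lt_mul_of_pos_right hK2 hη0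
    linarith
  have hF : 0 < cdfR μ q := lt_of_lt_of_le (by positivity) hqF
  have hr' : C' * N ^ (-β₁) ≤ K * η / 2 := by
    have h2 : C' * N ^ (-β₁) ≤ C' * η := by gcongr
    have := mul_le_mul_of_nonneg_right hK1 hη0.le
    linarith
  obtain ⟨hq1, hqN, hT⟩ := SOP.violation_location hτ0 hβ₁ hβ hC' hN0 hr' hμ hq0 hF hq
  replace hT := hT.trans (add_le_add_left hC.2 C')
  have hlogq0 : 0 ≤ Real.log q := Real.log_nonneg hq1
  have hlogq : Real.log q ≤ Real.log N / a := by
    rw [le_div_iff₀ ha]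
    have := Real.log_le_log (Real.rpow_pos_of_pos hq0 _) hqN
    rw [Real.log_rpow hq0] at this
    nlinarith [hτ.1]
  obtain ⟨k, hk1, hk2, hk3, hk4, hlogk⟩ := exists_consecutive_dyadic_scale ha hτ hN hℓ
  have hqk : (q : ℝ) ≤ 2 ^ k := by
    by_contra! hlt
    have := Real.rpow_lt_rpow (by positivity) hlt hτ0
    linarith
  have hkk : (2 : ℝ) ^ k ≤ 2 ^ (k + 1) := pow_le_pow_right₀ (by norm_num) (by omega)
  have hFk := hqF.trans (cdfR_mono μ hqk)
  have hFk' := hFk.trans (cdfR_mono μ hkk)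
  refine ⟨{q, 2 ^ k, 2 ^ (k + 1)}, fun τ₀ hτ₀ C₀ hC₀ ν hν hclose => ?_⟩
  have hprobν := hν.1
  have hGpos : ∀ x : ℝ, K * η / 2 / E ≤ cdfR μ x →
      |(1 - cdfR μ x) - (1 - cdfR ν x)| ≤ N ^ (-β₁) * ((1 - cdfR μ x) + (1 - cdfR ν x)) +
        A * η / N → 0 < cdfR ν x := by
    intro x hx hcr
    have h1 : A * η / N ≤ A * η := div_le_self (by positivity) hN
    have h2 : N ^ (-β₁) * ((1 - cdfR μ x) + (1 - cdfR ν x)) ≤ η * 2 := by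
      gcongr
      · linarith [cdfR_le_one μ x, cdfR_le_one ν x]
      · linarith [cdfR_nonneg μ x, cdfR_nonneg ν x]
    linarith [(abs_le.mp hcr).1]
  have cq := (hclose q (by simp)).1
  have ck := hclose (2 ^ k) (by simp)
  have ck' := hclose (2 ^ (k + 1)) (by simp)
  push_cast at ck ck'
  have hF2 : 0 < K * η / 2 / E := by positivity
  have rel := hrelN τ hτ C hC μ hμ τ₀ hτ₀ C₀ hC₀ ν hν (2 ^ k) (by positivity) hk1 hk2
    (hF2.trans_le hFk) (hGpos _ hFk ck.1) ck.1 (ck.2 k rfl)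
  have rel' := hrelN τ hτ C hC μ hμ τ₀ hτ₀ C₀ hC₀ ν hν (2 ^ (k + 1)) (by positivity) hk3 hk4
    (hF2.trans_le hFk') (hGpos _ hFk' ck'.1) ck'.1 (ck'.2 (k + 1) rfl)
  obtain ⟨hτclose, hlogC⟩ := abs_slope_le_of_consecutive rel rel'
  have hlogC' : |Real.log C₀ - Real.log C| ≤ κ' * η := by
    refine hlogC.trans ?_
    calc κ * N ^ (-β₁) * (1 + 4 * Real.log (2 ^ k))
        ≤ κ * N ^ (-β₁) * (Real.log N + 4 * ((Real.log (4 ^ b) + 1) / a * Real.log N)) := by gcongr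
      _ = κ' * η := by rw [hκ', hηd]; ring
  have hCC := abs_sub_le_of_abs_log_sub_le (hc.trans_le hC₀.1) hC0 hC.2 e6.le hlogC'
  have hz : |(τ₀ - τ) * Real.log q| ≤ 4 * κ / a * η := by
    rw [abs_mul, abs_of_nonneg hlogq0]
    calc |τ₀ - τ| * Real.log q ≤ 4 * (κ * N ^ (-β₁)) * (Real.log N / a) := by gcongr
      _ = _ := by rw [hηd]; ring
  have hwν := SOP.weighted_bound hν hq0 (hGpos _ hqF cq)
  have hfin := second_order_transfer (T := c₂ + C') (κ := 4 * κ / a) (κ' := 2 * c₂ * κ')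
    hq1 hτ0 hβ₀ hC' hN0 hqN hδ0.le e1.le hδη (by linarith) hA
    (sub_nonneg.mpr (cdfR_le_one μ q)) (sub_nonneg.mpr (cdfR_le_one ν q)) hT cq hz e4.le
    (by linarith) (hCC.trans_eq (by ring)) hwν
  rw [← hKc] at hfin
  have : Kc * η ≤ K * η / 2 := by
    have := mul_le_mul_of_nonneg_right hK3 hη0.le
    linarith
  linarith

lemma IsClosedIntervalPos.exists_subset_Icc {I : Set ℝ} (hI : IsClosedIntervalPos I) :
    ∃ a b : ℝ, 0 < a ∧ a ≤ b ∧ I ⊆ Icc a b := by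
  obtain ⟨⟨a, b, rfl⟩, hpos⟩ := hI
  rcases le_or_gt a b with h | h
  · exact ⟨a, b, hpos ⟨le_rfl, h⟩, h, subset_rfl⟩
  · exact ⟨1, 1, one_pos, le_rfl, by simp [Icc_eq_empty_of_lt h]⟩

lemma CloseOn.survival_sub_le {n : ℕ} {t Λ B lo hi : ℝ} {Q Q' : Set ℝ} {μ ν : Measure ℝ}
    {ω : Fin n → ℝ} (hμ : CloseOn t Λ B lo hi Q μ ω) (hν : CloseOn t Λ B lo hi Q' ν ω) {x : ℝ}
    (hx : x ∈ Q) (hx' : x ∈ Q') :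
    |(1 - cdfR μ x) - (1 - cdfR ν x)| ≤
      t * ((1 - cdfR μ x) + (1 - cdfR ν x)) + 2 * (Λ / (n * t)) ∧
    ∀ k : ℕ, x = 2 ^ k → lo ≤ 1 - cdfR μ x → 1 - cdfR μ x ≤ hi → lo ≤ 1 - cdfR ν x →
      1 - cdfR ν x ≤ hi → |(1 - cdfR μ x) - (1 - cdfR ν x)| ≤
        t * ((1 - cdfR μ x) + (1 - cdfR ν x)) + 2 * (B / (n * t)) := by
  have key : ∀ {e h g r s : ℝ}, |e - h| ≤ r → |e - g| ≤ s → |h - g| ≤ r + s := by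
    intro e h g r s h1 h2
    rw [abs_sub_comm] at h1
    exact (abs_sub_le h e g).trans (add_le_add h1 h2)
  refine ⟨(key (hμ x hx).1 (hν x hx').1).trans_eq (by ring), fun k hk h1 h2 h3 h4 => ?_⟩
  exact (key ((hμ x hx).2 k hk h1 h2) ((hν x hx').2 k hk h3 h4)).trans_eq (by ring)

lemma SOP.closeOn_prob_le {a b c₁ c₂ C' β w₁ w₂ ε p q : ℝ} (ha : 0 < a) (hc : 0 < c₁)
    (hC' : 0 < C') (hβ : 0 < β) (hw₁ : 0 < w₁) (hε : 0 < ε) (hp : 0 < p) (hq : 0 < q) :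
    ∃ B₀ : ℝ, ∀ B, B₀ ≤ B → ∀ᶠ n : ℕ in atTop, ∀ τ ∈ Icc a b, ∀ C ∈ Icc c₁ c₂,
      ∀ μ ∈ SOP τ β C C', (iidP μ n).real {ω | ¬ CloseOn (((n : ℝ) ^ p) ^ (-q))
        (2 * Real.log n + 2) B (w₁ / (n : ℝ) ^ p) (w₂ / (n : ℝ) ^ p) univ μ ω} ≤ ε := by
  obtain ⟨M, hM⟩ := SOP.dyadic_count (b := b) (c₂ := c₂) (w₂ := w₂) ha hc hC' hβ hw₁
  have h1 : Tendsto (fun B : ℝ => (M + 1 : ℝ) * (2 * Real.exp (-B))) atTop (nhds 0) := by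
    simpa using ((Real.tendsto_exp_neg_atTop_nhds_zero).const_mul 2).const_mul (M + 1 : ℝ)
  obtain ⟨B₀, hB₀⟩ := eventually_atTop.mp (h1.eventually (Iio_mem_nhds (half_pos hε)))
  have hN : Tendsto (fun n : ℕ => (n : ℝ) ^ p) atTop atTop :=
    (tendsto_rpow_atTop hp).comp tendsto_natCast_atTop_atTop
  have h2 : Tendsto (fun n : ℕ => (4 : ℝ) / n) atTop (nhds 0) :=
    tendsto_const_div_atTop_nhds_zero_nat 4
  refine ⟨B₀, fun B hB => ?_⟩
  filter_upwards [hN.eventually hM, h2.eventually (Iio_mem_nhds (half_pos hε)),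
    eventually_ge_atTop 1] with n hMn h2n hn τ hτ C hC μ hμ
  have hn1 : (1 : ℝ) ≤ n := by exact_mod_cast hn
  have hn0 : (0 : ℝ) < n := by linarith
  have hN0 : 0 < (n : ℝ) ^ p := Real.rpow_pos_of_pos hn0 p
  have := hμ.1
  refine (closeOn_prob μ (by omega) (Real.rpow_pos_of_pos hN0 _)
    (Real.rpow_le_one_of_one_le_of_nonpos (Real.one_le_rpow hn1 hp.le) (by linarith))
    (mul_nonneg zero_le_two (Real.log_nonneg hn1)) B (hMn τ hτ C hC μ hμ)).trans ?_
  have h3 : (n : ℝ) * (4 * Real.exp (-(2 * Real.log n))) = 4 / n := by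
    rw [Real.exp_neg, two_mul, Real.exp_add, Real.exp_log hn0]
    field_simp
  have h4 : (M + 1 : ℝ) * (2 * Real.exp (-B)) < ε / 2 := hB₀ B hB
  have h5 : (4 : ℝ) / n < ε / 2 := h2n
  rw [h3]
  linarith

/-- On the event that the empirical survival function is close to the true one, an alternative that
is well separated from the null hypothesis is not accepted. -/
lemma SOP.eventually_accept_subset {a b c₁ c₂ C' β₁ β₀ B : ℝ} (ha : 0 < a) (hab : a ≤ b)
    (hc : 0 < c₁) (hcc : c₁ ≤ c₂) (hC' : 0 < C') (hβ₁ : 0 < β₁) (hβ : β₁ < β₀) (hB : 0 ≤ B) :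
    ∃ K : ℝ, 0 < K ∧ ∀ᶠ n : ℕ in atTop, ∀ N : ℝ, N = (n : ℝ) ^ (1 / (2 * β₁ + 1)) →
      ∀ 𝓗 : Set (Measure ℝ), 𝓗 ⊆ (⋃ τ ∈ Icc a b, ⋃ C ∈ Icc c₁ c₂, SOP τ β₀ C C') →
      ∀ τ ∈ Icc a b, ∀ C ∈ Icc c₁ c₂, ∀ μ ∈ SOPsep τ β₁ β₀ C C' (K * (N ^ (-β₁) * Real.log N)),
        acceptRegion 𝓗 n (N ^ (-β₁)) (2 * Real.log n + 2) B
          (c₁ / (4 * 4 ^ b) / N) (3 * c₂ / N) ⊆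
        {ω | ¬ CloseOn (N ^ (-β₁)) (2 * Real.log n + 2) B
          (c₁ / (4 * 4 ^ b) / N) (3 * c₂ / N) univ μ ω} := by
  have hp : 0 < 2 * β₁ + 1 := by linarith
  obtain ⟨K, hK, hcore⟩ := SOP.exists_separating_points (A := 4 * (2 * β₁ + 1) + 4) (B := 2 * B)
    ha hab hc hcc hC' hβ₁ hβ (by positivity) (by positivity)
  have hNlim : Tendsto (fun n : ℕ => (n : ℝ) ^ (1 / (2 * β₁ + 1))) atTop atTop :=
    (tendsto_rpow_atTop (by positivity)).comp tendsto_natCast_atTop_atTop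
  refine ⟨K, hK, ?_⟩
  filter_upwards [hNlim.eventually hcore, eventually_gt_atTop 0,
    (Real.tendsto_log_atTop.comp hNlim).eventually_ge_atTop 1]
    with n hcn hn hℓ N hN 𝓗 h𝓗 τ hτ C hC μ hμ ω hω hclose
  simp only [Function.comp_apply, ← hN] at hcn hℓ
  have hn0 : (0 : ℝ) < n := by exact_mod_cast hn
  have hN0 : 0 < N := hN ▸ Real.rpow_pos_of_pos hn0 _
  have hδ : 0 < N ^ (-β₁) := Real.rpow_pos_of_pos hN0 _
  have hnN : (n : ℝ) = N ^ (2 * β₁ + 1) := by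
    rw [hN, ← Real.rpow_mul hn0.le, one_div, inv_mul_cancel₀ hp.ne', Real.rpow_one]
  have hlog : Real.log n = (2 * β₁ + 1) * Real.log N := by rw [hnN, Real.log_rpow hN0]
  have hinv : ∀ x : ℝ, x / (n * N ^ (-β₁)) = x * N ^ (-β₁) / N := by
    intro x
    have h1 : n * N ^ (-β₁) * N ^ (-β₁) = N := by
      rw [hnN, ← Real.rpow_add hN0, ← Real.rpow_add hN0]
      ring_nf
      exact Real.rpow_one N
    rw [div_eq_div_iff (by positivity) hN0.ne']
    calc x * N = x * (n * N ^ (-β₁) * N ^ (-β₁)) := by rw [h1]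
      _ = _ := by ring
  obtain ⟨Q, hQ⟩ := hcn τ hτ C hC μ hμ.1 hμ.2
  obtain ⟨ν, hν, hνc⟩ := hω Q
  have hν' := h𝓗 hν
  simp only [mem_iUnion, exists_prop] at hν'
  obtain ⟨τ₀, hτ₀, C₀, hC₀, hν'⟩ := hν'
  refine hQ τ₀ hτ₀ C₀ hC₀ ν hν' fun q hq => ?_
  obtain ⟨h1, h2⟩ := hclose.survival_sub_le hνc (mem_univ (q : ℝ)) ⟨q, hq, rfl⟩
  rw [hinv] at h1 h2
  refine ⟨h1.trans ?_, fun k hk g1 g2 g3 g4 => (h2 k hk g1 g2 g3 g4).trans_eq (by ring)⟩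
  gcongr
  have h5 : 2 * (2 * Real.log n + 2) ≤ (4 * (2 * β₁ + 1) + 4) * Real.log N := by
    rw [hlog]; linarith
  calc 2 * ((2 * Real.log n + 2) * N ^ (-β₁) / N)
      = 2 * (2 * Real.log n + 2) * N ^ (-β₁) / N := by ring
    _ ≤ (4 * (2 * β₁ + 1) + 4) * Real.log N * N ^ (-β₁) / N := by gcongr
    _ = _ := by ring

/-- Theorem 2: with unknown `τ ∈ I₁`, `C ∈ I₂`, for some `ρ_n` with
`limsup ρ_n·n^{β₁/(2β₁+1)}/log n < ∞` there is an `α`-uniformly consistent test of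
`H₀ : F ∈ ∪_{τ,C} S(τ,β₀,C,C')` vs `H₁ : F ∈ ∪_{τ,C} S̃(τ,β₁,β₀,C,C',ρ_n)`. -/
theorem composite_test_upper_bound
    (α β₀ β₁ C' : ℝ) (I₁ I₂ : Set ℝ) (hα : 0 < α) (hβ₁ : 0 < β₁) (hβ : β₁ < β₀)
    (hC' : 0 < C') (hI₁ : IsClosedIntervalPos I₁) (hI₂ : IsClosedIntervalPos I₂) :
    ∃ (ρ : ℕ → ℝ) (R : (n : ℕ) → Set (Fin n → ℝ)),
      (∀ n, 0 < ρ n) ∧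
      (∃ K : ℝ, ∀ᶠ n : ℕ in atTop,
        ρ n * (n : ℝ) ^ (β₁ / (2 * β₁ + 1)) / Real.log n ≤ K) ∧
      UnifConsistent α
        (fun _ => ⋃ τ ∈ I₁, ⋃ C ∈ I₂, SOP τ β₀ C C')
        (fun n => ⋃ τ ∈ I₁, ⋃ C ∈ I₂, SOPsep τ β₁ β₀ C C' (ρ n)) R := by
  obtain ⟨a, b, ha, hab, hI₁⟩ := hI₁.exists_subset_Icc
  obtain ⟨c₁, c₂, hc, hcc, hI₂⟩ := hI₂.exists_subset_Icc
  have hp : 0 < 1 / (2 * β₁ + 1) := by positivity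
  have hw₁ : (0 : ℝ) < c₁ / (4 * 4 ^ b) := by positivity
  obtain ⟨B₀, hB₀⟩ := SOP.closeOn_prob_le (b := b) (c₂ := c₂) (w₂ := 3 * c₂) ha hc hC'
    (hβ₁.trans hβ) hw₁ (half_pos hα) hp hβ₁
  obtain ⟨B₁, hB₁⟩ := SOP.closeOn_prob_le (b := b) (c₂ := c₂) (w₂ := 3 * c₂) ha hc hC'
    hβ₁ hw₁ (half_pos hα) hp hβ₁
  obtain ⟨B, hBdef⟩ : ∃ B, B = max 0 (max B₀ B₁) := ⟨_, rfl⟩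
  have hB : 0 ≤ B := hBdef ▸ le_max_left _ _
  specialize hB₀ B (hBdef ▸ (le_max_left _ _).trans (le_max_right _ _))
  specialize hB₁ B (hBdef ▸ (le_max_right _ _).trans (le_max_right _ _))
  obtain ⟨K, hK, hsub⟩ := SOP.eventually_accept_subset ha hab hc hcc hC' hβ₁ hβ hB
  let N : ℕ → ℝ := fun n => (n : ℝ) ^ (1 / (2 * β₁ + 1))
  have hN : ∀ n : ℕ, 2 ≤ n → 0 < N n ∧ Real.log (N n) = 1 / (2 * β₁ + 1) * Real.log n ∧
      0 < Real.log n := by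
    intro n hn
    have hn2 : (2 : ℝ) ≤ n := by exact_mod_cast hn
    exact ⟨Real.rpow_pos_of_pos (by linarith) _, Real.log_rpow (by linarith) _,
      Real.log_pos (by linarith)⟩
  let 𝓗 : Set (Measure ℝ) := ⋃ τ ∈ I₁, ⋃ C ∈ I₂, SOP τ β₀ C C'
  let G : (n : ℕ) → Set (Fin n → ℝ) := fun n =>
    acceptRegion 𝓗 n (N n ^ (-β₁)) (2 * Real.log n + 2) B (c₁ / (4 * 4 ^ b) / N n) (3 * c₂ / N n)
  have hG : ∀ n, MeasurableSet (G n) := fun n => measurableSet_acceptRegion _ _ _ _ _ _ _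
  refine ⟨fun n => if 2 ≤ n then K * (N n ^ (-β₁) * Real.log (N n)) else 1, fun n => (G n)ᶜ,
    fun n => ?_, ⟨K / (2 * β₁ + 1), ?_⟩, fun n => (hG n).compl, ?_⟩
  · dsimp only
    split_ifs with hn
    · obtain ⟨h1, h2, h3⟩ := hN n hn
      rw [h2]
      positivity
    · exact one_pos
  · filter_upwards [eventually_ge_atTop 2] with n hn
    obtain ⟨h1, h2, h3⟩ := hN n hn
    rw [if_pos hn, h2, div_le_iff₀ h3]
    have h4 : (n : ℝ) ^ (β₁ / (2 * β₁ + 1)) = N n ^ β₁ := by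
      rw [← Real.rpow_mul (Nat.cast_nonneg n)]
      congr 1
      ring
    have h5 : N n ^ (-β₁) * N n ^ β₁ = 1 := by
      rw [← Real.rpow_add h1, neg_add_cancel, Real.rpow_zero]
    rw [h4]
    refine le_of_eq ?_
    linear_combination (K * (1 / (2 * β₁ + 1) * Real.log n)) * h5
  · filter_upwards [hB₀, hB₁, hsub, eventually_ge_atTop 2] with n h₀ h₁ hs hn
    rw [if_pos hn, ← add_halves α]
    refine add_le_add (Real.iSup_le (fun μ => ?_) (half_pos hα).le)
      (Real.iSup_le (fun μ => ?_) (half_pos hα).le)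
    · obtain ⟨μ, hμ⟩ := μ
      have hμ' := hμ
      simp only [mem_iUnion, exists_prop] at hμ'
      obtain ⟨τ, hτ, C, hC, hμC⟩ := hμ'
      have := hμC.1
      refine (measureReal_mono ?_).trans (h₀ τ (hI₁ hτ) C (hI₂ hC) μ hμC)
      exact fun ω hω hclose => hω fun Q => ⟨μ, hμ, fun x _ => hclose x (mem_univ x)⟩
    · obtain ⟨μ, hμ⟩ := μ
      simp only [mem_iUnion, exists_prop] at hμ
      obtain ⟨τ, hτ, C, hC, hμC⟩ := hμ
      have := hμC.1.1
      have h6 := probReal_compl_eq_one_sub (μ := iidP μ n) (hG n)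
      rw [measureReal_def, measureReal_def] at h6
      rw [h6, sub_sub_cancel]
      refine (measureReal_mono ?_).trans (h₁ τ (hI₁ hτ) C (hI₂ hC) μ hμC.1)
      refine hs (N n) rfl 𝓗 ?_ τ (hI₁ hτ) C (hI₂ hC) μ hμC
      exact biUnion_mono hI₁ fun _ _ => biUnion_mono hI₂ fun _ _ => subset_rfl

end
end
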